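/- Let A be a smooth majority free finite idempotent algebra omitting type 1, and let a',b' in A be such that a'b' is an edge of the affine type witnessed by a maximal congruence θ of Sg{a',b'}. Then there are a in a'/θ and b in b'/θ such that ab is a Mal'tsev edge of A. -/

import Mathlib

/-! Common framework: universal algebras over a fixed signature, terms,
subalgebras, congruences, quotients, edges and their types (Bulatov's
coloured-graph approach), thin edges, connectivity, products, etc. -/

/-- A (functional) signature: a type of operation symbols with arities. -/
structure Signature where
  ops : Type
  arity : ops → ℕ

/-- An algebra of a given signature. -/
structure UAlgebra (σ : Signature) where
  carrier : Type
  interp : ∀ f : σ.ops, (Fin (σ.arity f) → carrier) → carrier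

/-- Terms over the signature `σ` in `n` variables. -/
inductive Term (σ : Signature) (n : ℕ) where
  | var : Fin n → Term σ n
  | app : (f : σ.ops) → (Fin (σ.arity f) → Term σ n) → Term σ n

/-- Evaluation of a term in an algebra; term operations of an algebra are
exactly the operations of the form `Term.eval A t`. -/
def Term.eval {σ : Signature} {n : ℕ} (A : UAlgebra σ) :
    Term σ n → (Fin n → A.carrier) → A.carrier
  | .var i, x => x i
  | .app f ts, x => A.interp f fun j => Term.eval A (ts j) x

namespace UAlgebra

variable {σ : Signature}

/-- An algebra is idempotent if all its basic operations are. -/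
def Idempotent (A : UAlgebra σ) : Prop :=
  ∀ (f : σ.ops) (a : A.carrier), A.interp f (fun _ => a) = a

/-- A set closed under all basic operations. -/
def IsClosed (A : UAlgebra σ) (S : Set A.carrier) : Prop :=
  ∀ (f : σ.ops) (x : Fin (σ.arity f) → A.carrier), (∀ j, x j ∈ S) → A.interp f x ∈ S

/-- Closure of a set under the basic operations. -/
inductive Closure (A : UAlgebra σ) (S : Set A.carrier) : A.carrier → Prop
  | base {a : A.carrier} : a ∈ S → Closure A S a
  | app (f : σ.ops) (x : Fin (σ.arity f) → A.carrier) :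
      (∀ j, Closure A S (x j)) → Closure A S (A.interp f x)

def ClosureSet (A : UAlgebra σ) (S : Set A.carrier) : Set A.carrier := {x | Closure A S x}

theorem closureSet_isClosed (A : UAlgebra σ) (S : Set A.carrier) :
    A.IsClosed (A.ClosureSet S) := fun f x h => Closure.app f x h

/-- The subalgebra of `A` on a closed subset `S`. -/
def subalg (A : UAlgebra σ) (S : Set A.carrier) (hS : A.IsClosed S) : UAlgebra σ where
  carrier := {x : A.carrier // x ∈ S}
  interp f x := ⟨A.interp f fun j => (x j : A.carrier), hS f _ fun j => (x j).2⟩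

/-- The subalgebra generated by a set `S`. -/
def Sg (A : UAlgebra σ) (S : Set A.carrier) : UAlgebra σ :=
  A.subalg (A.ClosureSet S) (A.closureSet_isClosed S)

/-- `a` as an element of `Sg {a, b}`. -/
def sgA (A : UAlgebra σ) (a b : A.carrier) : (A.Sg {a, b}).carrier :=
  ⟨a, Closure.base (Set.mem_insert a {b})⟩

/-- `b` as an element of `Sg {a, b}`. -/
def sgB (A : UAlgebra σ) (a b : A.carrier) : (A.Sg {a, b}).carrier :=
  ⟨b, Closure.base (Set.mem_insert_iff.mpr (Or.inr rfl))⟩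

/-- A congruence of an algebra. -/
structure Congruence (A : UAlgebra σ) where
  rel : A.carrier → A.carrier → Prop
  refl : ∀ x, rel x x
  symm : ∀ {x y}, rel x y → rel y x
  trans : ∀ {x y z}, rel x y → rel y z → rel x z
  compat : ∀ (f : σ.ops) (x y : Fin (σ.arity f) → A.carrier),
      (∀ j, rel (x j) (y j)) → rel (A.interp f x) (A.interp f y)

def Congruence.toSetoid {A : UAlgebra σ} (θ : Congruence A) : Setoid A.carrier :=
  ⟨θ.rel, ⟨θ.refl, θ.symm, θ.trans⟩⟩

/-- The full congruence. -/
def Congruence.IsFull {A : UAlgebra σ} (θ : Congruence A) : Prop := ∀ x y, θ.rel x y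

def Congruence.le {A : UAlgebra σ} (θ η : Congruence A) : Prop :=
  ∀ x y, θ.rel x y → η.rel x y

/-- A maximal congruence: proper, and any congruence above it is full or below it. -/
def Congruence.IsMaximal {A : UAlgebra σ} (θ : Congruence A) : Prop :=
  ¬ θ.IsFull ∧ ∀ η : Congruence A, θ.le η → ¬ η.IsFull → η.le θ

/-- The quotient (factor) algebra. -/
noncomputable def quot (A : UAlgebra σ) (θ : Congruence A) : UAlgebra σ where
  carrier := Quotient θ.toSetoid
  interp f x := Quotient.mk θ.toSetoid (A.interp f fun j => (x j).out)

/-- The class of `a` in the quotient of `Sg {a,b}` by `θ`. -/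
def qa (A : UAlgebra σ) (a b : A.carrier) (θ : Congruence (A.Sg {a, b})) :
    ((A.Sg {a, b}).quot θ).carrier :=
  Quotient.mk θ.toSetoid (A.sgA a b)

def qb (A : UAlgebra σ) (a b : A.carrier) (θ : Congruence (A.Sg {a, b})) :
    ((A.Sg {a, b}).quot θ).carrier :=
  Quotient.mk θ.toSetoid (A.sgB a b)

end UAlgebra

/-- A binary operation is a semilattice operation on a set `B`. -/
def IsSemilatticeOn {α : Type} (f : α → α → α) (B : Set α) : Prop :=
  (∀ x ∈ B, f x x = x) ∧ (∀ x ∈ B, ∀ y ∈ B, f x y = f y x) ∧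
    (∀ x ∈ B, ∀ y ∈ B, ∀ z ∈ B, f x (f y z) = f (f x y) z)

/-- A ternary operation is a majority operation on a set `B`. -/
def IsMajorityOn {α : Type} (g : α → α → α → α) (B : Set α) : Prop :=
  ∀ x ∈ B, ∀ y ∈ B, g x x y = x ∧ g x y x = x ∧ g y x x = x

/-- A ternary operation is a Mal'tsev operation on a set `B`. -/
def IsMaltsevOn {α : Type} (h : α → α → α → α) (B : Set α) : Prop :=
  ∀ x ∈ B, ∀ y ∈ B, h x y y = x ∧ h y y x = x

namespace UAlgebra

variable {σ : Signature}

/-- An algebra is "a set": every term operation is a projection. -/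
def IsSetAlgebra (Q : UAlgebra σ) : Prop :=
  ∀ (n : ℕ) (t : Term σ n), ∃ i : Fin n, ∀ x : Fin n → Q.carrier, t.eval Q x = x i

/-- An algebra is the full idempotent reduct of a module over some finite ring:
its term operations are exactly the idempotent affine combinations; in
particular the affine operation `x - y + z` is a term operation. -/
def IsAffineAlgebra (Q : UAlgebra σ) : Prop :=
  ∃ (R : Type) (_ : Ring R) (_ : Finite R) (_ : AddCommGroup Q.carrier)
    (_ : Module R Q.carrier),
    (∀ (n : ℕ) (g : (Fin n → Q.carrier) → Q.carrier),
      (∃ t : Term σ n, ∀ x, t.eval Q x = g x) ↔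
      (∃ c : Fin n → R, (∑ i, c i) = 1 ∧ ∀ x, g x = ∑ i, c i • x i)) ∧
    (∃ t : Term σ 3, ∀ x y z : Q.carrier, t.eval Q ![x, y, z] = x - y + z)

/-- `θ` witnesses that `ab` is an edge of the unary type. -/
def UnaryWitness (A : UAlgebra σ) (a b : A.carrier) (θ : Congruence (A.Sg {a, b})) : Prop :=
  θ.IsMaximal ∧ IsSetAlgebra ((A.Sg {a, b}).quot θ)

/-- `θ` witnesses that `ab` is an edge of the semilattice type. -/
def SLWitness (A : UAlgebra σ) (a b : A.carrier) (θ : Congruence (A.Sg {a, b})) : Prop :=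
  θ.IsMaximal ∧ ∃ t : Term σ 2,
    IsSemilatticeOn (fun x y => t.eval ((A.Sg {a, b}).quot θ) ![x, y])
      {A.qa a b θ, A.qb a b θ}

/-- `θ` witnesses that `ab` is an edge of the majority type. -/
def MajWitness (A : UAlgebra σ) (a b : A.carrier) (θ : Congruence (A.Sg {a, b})) : Prop :=
  θ.IsMaximal ∧
  (∃ t : Term σ 3,
    IsMajorityOn (fun x y z => t.eval ((A.Sg {a, b}).quot θ) ![x, y, z])
      {A.qa a b θ, A.qb a b θ}) ∧
  ¬ (∃ t : Term σ 2,
    IsSemilatticeOn (fun x y => t.eval ((A.Sg {a, b}).quot θ) ![x, y])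
      {A.qa a b θ, A.qb a b θ})

/-- `θ` witnesses that `ab` is an edge of the affine type. -/
def AffWitness (A : UAlgebra σ) (a b : A.carrier) (θ : Congruence (A.Sg {a, b})) : Prop :=
  θ.IsMaximal ∧ IsAffineAlgebra ((A.Sg {a, b}).quot θ)

/-- A pair of distinct elements is an edge. -/
def IsEdge (A : UAlgebra σ) (a b : A.carrier) : Prop :=
  a ≠ b ∧ ∃ θ : Congruence (A.Sg {a, b}), ¬ θ.IsFull ∧
    (IsSetAlgebra ((A.Sg {a, b}).quot θ) ∨
     IsAffineAlgebra ((A.Sg {a, b}).quot θ) ∨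
     (∃ t : Term σ 2,
        IsSemilatticeOn (fun x y => t.eval ((A.Sg {a, b}).quot θ) ![x, y])
          {A.qa a b θ, A.qb a b θ}) ∨
     (∃ t : Term σ 3,
        IsMajorityOn (fun x y z => t.eval ((A.Sg {a, b}).quot θ) ![x, y, z])
          {A.qa a b θ, A.qb a b θ}))

def IsUnaryEdge (A : UAlgebra σ) (a b : A.carrier) : Prop :=
  a ≠ b ∧ ∃ θ : Congruence (A.Sg {a, b}), UnaryWitness A a b θ

def IsSLEdge (A : UAlgebra σ) (a b : A.carrier) : Prop :=
  a ≠ b ∧ ∃ θ : Congruence (A.Sg {a, b}), SLWitness A a b θ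

def IsMajEdge (A : UAlgebra σ) (a b : A.carrier) : Prop :=
  a ≠ b ∧ ∃ θ : Congruence (A.Sg {a, b}), MajWitness A a b θ

def IsAffEdge (A : UAlgebra σ) (a b : A.carrier) : Prop :=
  a ≠ b ∧ ∃ θ : Congruence (A.Sg {a, b}), AffWitness A a b θ

end UAlgebra

/-- The four types of edges. -/
inductive EdgeType where
  | unary | semilattice | majority | affine
deriving DecidableEq

namespace UAlgebra

variable {σ : Signature}

def HasEdgeOfType (A : UAlgebra σ) (τ : EdgeType) (a b : A.carrier) : Prop :=
  match τ with
  | .unary => A.IsUnaryEdge a b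
  | .semilattice => A.IsSLEdge a b
  | .majority => A.IsMajEdge a b
  | .affine => A.IsAffEdge a b

/-- `T`-restricted algebra: every edge has a type from `T`. -/
def Restricted (A : UAlgebra σ) (T : Set EdgeType) : Prop :=
  ∀ a b : A.carrier, A.IsEdge a b → ∃ τ ∈ T, A.HasEdgeOfType τ a b

/-- `A` omits type 1: no subalgebra of `A` has an edge of the unary type. -/
def OmitsType1 (A : UAlgebra σ) : Prop :=
  ∀ (S : Set A.carrier) (hS : A.IsClosed S) (a b : (A.subalg S hS).carrier),
    ¬ (A.subalg S hS).IsUnaryEdge a b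

/-- The union of the two `θ`-blocks of a thick edge, as a subset of `A`. -/
def edgeBlockUnion (A : UAlgebra σ) (a b : A.carrier) (θ : Congruence (A.Sg {a, b})) :
    Set A.carrier :=
  {x | ∃ hx : x ∈ A.ClosureSet {a, b},
    θ.rel ⟨x, hx⟩ (A.sgA a b) ∨ θ.rel ⟨x, hx⟩ (A.sgB a b)}

/-- Smooth algebra: for every semilattice- or majority-type edge with a witnessing
maximal congruence, the union of the two blocks is a subuniverse. -/
def IsSmooth (A : UAlgebra σ) : Prop :=
  ∀ (a b : A.carrier) (θ : Congruence (A.Sg {a, b})),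
    (SLWitness A a b θ ∨ MajWitness A a b θ) → A.IsClosed (A.edgeBlockUnion a b θ)

def SemilatticeFree (A : UAlgebra σ) : Prop := ∀ a b : A.carrier, ¬ A.IsSLEdge a b
def MajorityFree (A : UAlgebra σ) : Prop := ∀ a b : A.carrier, ¬ A.IsMajEdge a b
def AffineFree (A : UAlgebra σ) : Prop := ∀ a b : A.carrier, ¬ A.IsAffEdge a b

/-- Thin semilattice edge. -/
def IsThinSLEdge (A : UAlgebra σ) (a b : A.carrier) : Prop :=
  ∃ t : Term σ 2, t.eval A ![a, a] = a ∧ t.eval A ![a, b] = b ∧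
    t.eval A ![b, a] = b ∧ t.eval A ![b, b] = b

/-- Undirected thin majority edge: some term operation is majority on `{a, b}`. -/
def IsUndirThinMajEdge (A : UAlgebra σ) (a b : A.carrier) : Prop :=
  ∃ t : Term σ 3, IsMajorityOn (fun x y z => t.eval A ![x, y, z]) {a, b}

/-- Mal'tsev edge: some term operation is Mal'tsev on `{a, b}`. -/
def IsMaltsevEdge (A : UAlgebra σ) (a b : A.carrier) : Prop :=
  ∃ t : Term σ 3, IsMaltsevOn (fun x y z => t.eval A ![x, y, z]) {a, b}

/-- The class of all quotients of subalgebras of `A`. -/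
def QuotSub (A : UAlgebra σ) : Set (UAlgebra σ) :=
  {B | ∃ (S : Set A.carrier) (hS : A.IsClosed S)
        (θ : Congruence (A.subalg S hS)), B = (A.subalg S hS).quot θ}

end UAlgebra

/-- The class of all quotients of subalgebras of the algebras of a class. -/
def QuotSubClass {σ : Signature} (K : Set (UAlgebra σ)) : Set (UAlgebra σ) :=
  {B | ∃ A ∈ K, B ∈ UAlgebra.QuotSub A}

/-- A ternary term satisfies the majority condition relative to a class `𝒦`. -/
def MajorityCondition {σ : Signature} (𝒦 : Set (UAlgebra σ)) (t : Term σ 3) : Prop :=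
  (∀ B ∈ 𝒦, ∀ x y : B.carrier,
    t.eval B ![x, t.eval B ![x, y, y], t.eval B ![x, y, y]] = t.eval B ![x, y, y]) ∧
  (∀ B ∈ 𝒦, ∀ (a b : B.carrier) (θ : UAlgebra.Congruence (B.Sg {a, b})),
    a ≠ b → UAlgebra.MajWitness B a b θ →
    IsMajorityOn (fun x y z => t.eval ((B.Sg {a, b}).quot θ) ![x, y, z])
      {B.qa a b θ, B.qb a b θ})

/-- A ternary term satisfies the minority condition relative to a class `𝒦`. -/
def MinorityCondition {σ : Signature} (𝒦 : Set (UAlgebra σ)) (t : Term σ 3) : Prop :=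
  (∀ B ∈ 𝒦, ∀ x y : B.carrier,
    t.eval B ![t.eval B ![x, y, y], y, y] = t.eval B ![x, y, y]) ∧
  (∀ B ∈ 𝒦, ∀ (a b : B.carrier) (θ : UAlgebra.Congruence (B.Sg {a, b})),
    a ≠ b → UAlgebra.AffWitness B a b θ →
    IsMaltsevOn (fun x y z => t.eval ((B.Sg {a, b}).quot θ) ![x, y, z])
      {B.qa a b θ, B.qb a b θ})

/-- Thin majority edge relative to a class `𝒦`. -/
def IsThinMajEdge {σ : Signature} (𝒦 : Set (UAlgebra σ)) (A : UAlgebra σ)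
    (a b : A.carrier) : Prop :=
  ∀ t : Term σ 3, MajorityCondition 𝒦 t →
    b ∈ A.ClosureSet {a, t.eval A ![a, b, b]} ∧
    b ∈ A.ClosureSet {a, t.eval A ![b, a, b]} ∧
    b ∈ A.ClosureSet {a, t.eval A ![b, b, a]}

/-- Thin affine edge relative to a class `𝒦` (with respect to some fixed term
operation satisfying the minority condition). -/
def IsThinAffEdge {σ : Signature} (𝒦 : Set (UAlgebra σ)) (A : UAlgebra σ)
    (a b : A.carrier) : Prop :=
  (∃ t : Term σ 3, MinorityCondition 𝒦 t ∧ t.eval A ![b, a, a] = b) ∧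
  ∀ t : Term σ 3, MinorityCondition 𝒦 t → b ∈ A.ClosureSet {a, t.eval A ![a, a, b]}

namespace UAlgebra

variable {σ : Signature}

/-- Reachability in the digraph `Gs(A)` of thin semilattice edges. -/
def sReach (A : UAlgebra σ) : A.carrier → A.carrier → Prop :=
  Relation.ReflTransGen (fun x y => A.IsThinSLEdge x y)

/-- A maximal element of `Gs(A)`: an element of a maximal strongly connected
component. -/
def IsMaxElem (A : UAlgebra σ) (a : A.carrier) : Prop :=
  ∀ b, A.sReach a b → A.sReach b a

/-- A maximal component of `Gs(A)`: the strongly connected component of a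
maximal element. -/
def IsMaxComponent (A : UAlgebra σ) (C : Set A.carrier) : Prop :=
  ∃ a, A.IsMaxElem a ∧ C = {b | A.sReach a b ∧ A.sReach b a}

end UAlgebra

/-- An arc of the digraph `Gas(A)`: a thin semilattice or thin affine edge. -/
def asStep {σ : Signature} (𝒦 : Set (UAlgebra σ)) (A : UAlgebra σ)
    (x y : A.carrier) : Prop :=
  A.IsThinSLEdge x y ∨ IsThinAffEdge 𝒦 A x y

/-- Reachability in `Gas(A)`. -/
def asReach {σ : Signature} (𝒦 : Set (UAlgebra σ)) (A : UAlgebra σ) :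
    A.carrier → A.carrier → Prop :=
  Relation.ReflTransGen (asStep 𝒦 A)

/-- An as-maximal element: an element of an as-component. -/
def IsAsMaxElem {σ : Signature} (𝒦 : Set (UAlgebra σ)) (A : UAlgebra σ)
    (a : A.carrier) : Prop :=
  ∀ b, asReach 𝒦 A a b → asReach 𝒦 A b a

/-- An as-component of `A`: a maximal strongly connected component of `Gas(A)`. -/
def IsAsComponent {σ : Signature} (𝒦 : Set (UAlgebra σ)) (A : UAlgebra σ)
    (C : Set A.carrier) : Prop :=
  ∃ a, IsAsMaxElem 𝒦 A a ∧ C = {b | asReach 𝒦 A a b ∧ asReach 𝒦 A b a}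

namespace UAlgebra

variable {σ : Signature}

/-- Binary direct product. -/
def prod (A B : UAlgebra σ) : UAlgebra σ where
  carrier := A.carrier × B.carrier
  interp f x := (A.interp f fun j => (x j).1, B.interp f fun j => (x j).2)

/-- Direct product of a family. -/
def pi {ι : Type} (A : ι → UAlgebra σ) : UAlgebra σ where
  carrier := ∀ i, (A i).carrier
  interp f x := fun i => (A i).interp f fun j => x j i

/-- Homomorphism of similar algebras. -/
def IsHom (A B : UAlgebra σ) (φ : A.carrier → B.carrier) : Prop :=
  ∀ (f : σ.ops) (x : Fin (σ.arity f) → A.carrier),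
    φ (A.interp f x) = B.interp f fun j => φ (x j)

/-- Simple algebra: only the equality and full congruences. -/
def IsSimple (A : UAlgebra σ) : Prop :=
  ∀ θ : Congruence A, (∀ x y, θ.rel x y ↔ x = y) ∨ θ.IsFull

/-- Maximal generated algebra: generated by one of its maximal components. -/
def MaximalGenerated (A : UAlgebra σ) : Prop :=
  ∃ C : Set A.carrier, A.IsMaxComponent C ∧ A.ClosureSet C = Set.univ

/-- The number of subalgebras (nonempty closed subsets) of an algebra. -/
noncomputable def numSubalgebras (A : UAlgebra σ) : ℕ :=
  Nat.card {S : Set A.carrier // S.Nonempty ∧ A.IsClosed S}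

end UAlgebra

/-- A (k+3)-ary term is an edge term for a class `𝒦`. -/
def IsEdgeTermFor {σ : Signature} (𝒦 : Set (UAlgebra σ)) {k : ℕ}
    (t : Term σ (k + 3)) : Prop :=
  ∀ A ∈ 𝒦, ∀ x y : A.carrier,
    t.eval A (fun i => if i.val ≤ 1 then y else x) = x ∧
    t.eval A (fun i => if i.val = 0 ∨ i.val = 2 then y else x) = x ∧
    ∀ j : Fin (k + 3), 3 ≤ j.val →
      t.eval A (Function.update (fun _ => x) j y) = x

/-- A finite class has few subproducts. -/
def FewSubproducts {σ : Signature} (K : Set (UAlgebra σ)) : Prop :=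
  ∃ p : Polynomial ℕ, ∀ (n : ℕ) (A : Fin n → UAlgebra σ), (∀ i, A i ∈ K) →
    UAlgebra.numSubalgebras (UAlgebra.pi A) ≤ 2 ^ (p.eval n)

/-- `g_K` is bounded by a polynomial: every subalgebra of an `n`-fold product
of members of `K` has a generating set of polynomial size. -/
def PolyGenerated {σ : Signature} (K : Set (UAlgebra σ)) : Prop :=
  ∃ p : Polynomial ℕ, ∀ (n : ℕ) (A : Fin n → UAlgebra σ), (∀ i, A i ∈ K) →
    ∀ S : Set (UAlgebra.pi A).carrier, S.Nonempty → (UAlgebra.pi A).IsClosed S →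
      ∃ G : Set (UAlgebra.pi A).carrier, G ⊆ S ∧ G.Finite ∧
        G.ncard ≤ p.eval n ∧ (UAlgebra.pi A).ClosureSet G = S

/-- Substitution of terms for the variables of a term. -/
def Term.subst {σ : Signature} {n m : ℕ} : Term σ n → (Fin n → Term σ m) → Term σ m
  | .var i, u => u i
  | .app f ts, u => .app f fun j => (ts j).subst u

theorem Term.eval_subst {σ : Signature} {n m : ℕ} (A : UAlgebra σ) (t : Term σ n)
    (u : Fin n → Term σ m) (x : Fin m → A.carrier) :
    (t.subst u).eval A x = t.eval A fun i => (u i).eval A x := by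
  induction t with
  | var i => rfl
  | app f ts ih => simp only [Term.subst, Term.eval, ih]

namespace UAlgebra

variable {σ : Signature}

/-- A term operation of an algebra. -/
def TermOp (A : UAlgebra σ) {n : ℕ} (g : (Fin n → A.carrier) → A.carrier) : Prop :=
  ∃ t : Term σ n, ∀ x, t.eval A x = g x

/-- A binary term operation, in curried form. -/
def Op2 (A : UAlgebra σ) (g : A.carrier → A.carrier → A.carrier) : Prop :=
  A.TermOp fun x : Fin 2 → A.carrier => g (x 0) (x 1)

/-- A ternary term operation, in curried form. -/
def Op3 (A : UAlgebra σ) (g : A.carrier → A.carrier → A.carrier → A.carrier) : Prop :=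
  A.TermOp fun x : Fin 3 → A.carrier => g (x 0) (x 1) (x 2)

variable {A : UAlgebra σ}

theorem TermOp.proj {n : ℕ} (i : Fin n) : A.TermOp fun x : Fin n → A.carrier => x i :=
  ⟨.var i, fun _ => rfl⟩

theorem TermOp.comp {n m : ℕ} {F : (Fin n → A.carrier) → A.carrier} (hF : A.TermOp F)
    {g : Fin n → (Fin m → A.carrier) → A.carrier} (hg : ∀ i, A.TermOp (g i)) :
    A.TermOp fun x => F fun i => g i x := by
  obtain ⟨t, ht⟩ := hF
  choose u hu using hg
  exact ⟨t.subst u, fun x => by simp only [Term.eval_subst, hu, ht]⟩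

theorem Op2.comp {m : ℕ} {p : A.carrier → A.carrier → A.carrier} (hp : A.Op2 p)
    {g h : (Fin m → A.carrier) → A.carrier} (hg : A.TermOp g) (hh : A.TermOp h) :
    A.TermOp fun x => p (g x) (h x) :=
  TermOp.comp (g := ![g, h]) hp (Fin.forall_fin_two.mpr ⟨hg, hh⟩)

theorem Op3.comp {m : ℕ} {p : A.carrier → A.carrier → A.carrier → A.carrier} (hp : A.Op3 p)
    {g h k : (Fin m → A.carrier) → A.carrier} (hg : A.TermOp g) (hh : A.TermOp h)
    (hk : A.TermOp k) : A.TermOp fun x => p (g x) (h x) (k x) :=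
  TermOp.comp (g := ![g, h, k]) hp
    (Fin.forall_fin_succ.mpr ⟨hg, Fin.forall_fin_two.mpr ⟨hh, hk⟩⟩)

theorem TermOp.basic (f : σ.ops) : A.TermOp (A.interp f) :=
  ⟨.app f .var, fun _ => rfl⟩

theorem op2_fst : A.Op2 fun x _ => x := TermOp.proj 0

theorem Op2.flip {p : A.carrier → A.carrier → A.carrier} (hp : A.Op2 p) :
    A.Op2 fun x y => p y x := hp.comp (TermOp.proj 1) (TermOp.proj 0)

theorem Op2.comp2 {p g h : A.carrier → A.carrier → A.carrier} (hp : A.Op2 p)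
    (hg : A.Op2 g) (hh : A.Op2 h) : A.Op2 fun x y => p (g x y) (h x y) :=
  Op2.comp hp hg hh

theorem Op2.exists_eval {p : A.carrier → A.carrier → A.carrier} (hp : A.Op2 p) :
    ∃ t : Term σ 2, ∀ x y, t.eval A ![x, y] = p x y :=
  hp.imp fun _ ht x y => ht ![x, y]

theorem op2_of_term (t : Term σ 2) : A.Op2 fun x y => t.eval A ![x, y] :=
  ⟨t, fun x => congrArg _ (by ext i; fin_cases i <;> rfl)⟩

theorem Op3.exists_eval {p : A.carrier → A.carrier → A.carrier → A.carrier} (hp : A.Op3 p) :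
    ∃ t : Term σ 3, ∀ x y z, t.eval A ![x, y, z] = p x y z :=
  hp.imp fun _ ht x y z => ht ![x, y, z]

theorem op3_of_term (t : Term σ 3) : A.Op3 fun x y z => t.eval A ![x, y, z] :=
  ⟨t, fun x => congrArg _ (by ext i; fin_cases i <;> rfl)⟩

theorem TermOp.idem (hid : A.Idempotent) {n : ℕ} {g : (Fin n → A.carrier) → A.carrier}
    (hg : A.TermOp g) (a : A.carrier) : (g fun _ => a) = a := by
  obtain ⟨t, ht⟩ := hg
  rw [← ht]
  clear ht
  induction t with
  | var i => rfl
  | app f ts ih =>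
    simp only [Term.eval, ih]
    exact hid f a

theorem Op2.idem (hid : A.Idempotent) {p : A.carrier → A.carrier → A.carrier} (hp : A.Op2 p)
    (a : A.carrier) : p a a = a := TermOp.idem hid hp a

theorem Op3.idem (hid : A.Idempotent) {p : A.carrier → A.carrier → A.carrier → A.carrier}
    (hp : A.Op3 p) (a : A.carrier) : p a a a = a := TermOp.idem hid hp a

theorem IsClosed.termOp {S : Set A.carrier} (hS : A.IsClosed S) {n : ℕ}
    {g : (Fin n → A.carrier) → A.carrier} (hg : A.TermOp g) {x : Fin n → A.carrier}
    (hx : ∀ i, x i ∈ S) : g x ∈ S := by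
  obtain ⟨t, ht⟩ := hg
  rw [← ht]
  clear ht
  induction t with
  | var i => exact hx i
  | app f ts ih => exact hS f _ ih

theorem IsClosed.op2 {S : Set A.carrier} (hS : A.IsClosed S)
    {p : A.carrier → A.carrier → A.carrier} (hp : A.Op2 p) {x y : A.carrier}
    (hx : x ∈ S) (hy : y ∈ S) : p x y ∈ S :=
  hS.termOp (x := ![x, y]) hp (Fin.forall_fin_two.mpr ⟨hx, hy⟩)

theorem IsClosed.op3 {S : Set A.carrier} (hS : A.IsClosed S)
    {p : A.carrier → A.carrier → A.carrier → A.carrier} (hp : A.Op3 p) {x y z : A.carrier}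
    (hx : x ∈ S) (hy : y ∈ S) (hz : z ∈ S) : p x y z ∈ S :=
  hS.termOp (x := ![x, y, z]) hp (Fin.forall_fin_succ.mpr ⟨hx, Fin.forall_fin_two.mpr ⟨hy, hz⟩⟩)

/-- A binary relation preserved by all basic operations. -/
def Invariant (A : UAlgebra σ) (R : A.carrier → A.carrier → Prop) : Prop :=
  ∀ (f : σ.ops) (x y : Fin (σ.arity f) → A.carrier), (∀ j, R (x j) (y j)) →
    R (A.interp f x) (A.interp f y)

theorem Invariant.termOp {R : A.carrier → A.carrier → Prop} (hR : A.Invariant R) {n : ℕ}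
    {g : (Fin n → A.carrier) → A.carrier} (hg : A.TermOp g) {x y : Fin n → A.carrier}
    (h : ∀ i, R (x i) (y i)) : R (g x) (g y) := by
  obtain ⟨t, ht⟩ := hg
  rw [← ht, ← ht]
  clear ht
  induction t with
  | var i => exact h i
  | app f ts ih => exact hR f _ _ ih

theorem Invariant.op2 {R : A.carrier → A.carrier → Prop} (hR : A.Invariant R)
    {p : A.carrier → A.carrier → A.carrier} (hp : A.Op2 p) {x y x' y' : A.carrier}
    (hx : R x x') (hy : R y y') : R (p x y) (p x' y') :=
  hR.termOp (x := ![x, y]) (y := ![x', y']) hp (Fin.forall_fin_two.mpr ⟨hx, hy⟩)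

theorem Invariant.op3 {R : A.carrier → A.carrier → Prop} (hR : A.Invariant R)
    {p : A.carrier → A.carrier → A.carrier → A.carrier} (hp : A.Op3 p)
    {x y z x' y' z' : A.carrier} (hx : R x x') (hy : R y y') (hz : R z z') :
    R (p x y z) (p x' y' z') :=
  hR.termOp (x := ![x, y, z]) (y := ![x', y', z']) hp
    (Fin.forall_fin_succ.mpr ⟨hx, Fin.forall_fin_two.mpr ⟨hy, hz⟩⟩)

theorem mem_closureSet_pair {z v x : A.carrier} :
    x ∈ A.ClosureSet {z, v} ↔ ∃ q, A.Op2 q ∧ q z v = x := by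
  constructor
  · intro hx
    induction hx with
    | base h =>
      rcases h with rfl | rfl
      · exact ⟨_, op2_fst, rfl⟩
      · exact ⟨_, op2_fst.flip, rfl⟩
    | app f x _ ih =>
      choose q hq h using ih
      exact ⟨fun a b => A.interp f fun j => q j a b, TermOp.comp (TermOp.basic f) hq,
        by simp only [h]⟩
  · rintro ⟨q, hq, rfl⟩
    exact (A.closureSet_isClosed _).op2 hq (.base (by simp)) (.base (by simp))

theorem eval_subalg {S : Set A.carrier} (hS : A.IsClosed S) {n : ℕ} (t : Term σ n)
    (x : Fin n → (A.subalg S hS).carrier) :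
    (t.eval (A.subalg S hS) x).1 = t.eval A fun i => (x i).1 := by
  induction t with
  | var i => rfl
  | app f ts ih => simp only [Term.eval, subalg, ← ih]

theorem quot_interp (θ : Congruence A) (f : σ.ops) (x : Fin (σ.arity f) → A.carrier) :
    (A.quot θ).interp f (fun j => Quotient.mk θ.toSetoid (x j)) =
      Quotient.mk θ.toSetoid (A.interp f x) :=
  Quotient.sound (θ.compat f _ _ fun j =>
    Quotient.exact (s := θ.toSetoid) (Quotient.out_eq (Quotient.mk θ.toSetoid (x j))))

theorem eval_quot (θ : Congruence A) {n : ℕ} (t : Term σ n) (x : Fin n → A.carrier) :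
    t.eval (A.quot θ) (fun i => Quotient.mk θ.toSetoid (x i)) =
      Quotient.mk θ.toSetoid (t.eval A x) := by
  induction t with
  | var i => rfl
  | app f ts ih =>
    simp only [Term.eval, ih]
    exact quot_interp θ f _

end UAlgebra

namespace UAlgebra

variable {σ : Signature} {A : UAlgebra σ}

theorem mem_closureSet_left (z v : A.carrier) : z ∈ A.ClosureSet {z, v} := .base (by simp)

theorem mem_closureSet_right (z v : A.carrier) : v ∈ A.ClosureSet {z, v} := .base (by simp)

theorem closureSet_subset {S T : Set A.carrier} (hT : A.IsClosed T) (h : S ⊆ T) :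
    A.ClosureSet S ⊆ T := by
  intro x hx
  induction hx with
  | base hx => exact h hx
  | app f x _ ih => exact hT f x ih

/-- Every proper congruence of a finite algebra is below a maximal one. -/
theorem Congruence.exists_isMaximal [Finite A.carrier] (θ : Congruence A) (hθ : ¬ θ.IsFull) :
    ∃ η : Congruence A, η.IsMaximal ∧ θ.le η := by
  let P : Set (A.carrier → A.carrier → Prop) :=
    {r | ∃ η : Congruence A, η.rel = r ∧ ¬ η.IsFull}
  obtain ⟨r, hr, hmax⟩ := P.toFinite.exists_le_maximal (a := θ.rel) ⟨θ, rfl, hθ⟩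
  obtain ⟨η, rfl, hη⟩ := hmax.prop
  refine ⟨η, ⟨hη, fun η' hle hη' => ?_⟩, hr⟩
  exact hmax.le_of_ge ⟨η', rfl, hη'⟩ hle

/-- A congruence of a subalgebra, viewed as a relation on the whole algebra. -/
def Congruence.lift {S : Set A.carrier} {hS : A.IsClosed S} (η : Congruence (A.subalg S hS))
    (x y : A.carrier) : Prop :=
  ∃ (hx : x ∈ S) (hy : y ∈ S), η.rel ⟨x, hx⟩ ⟨y, hy⟩

section lift

variable {S : Set A.carrier} {hS : A.IsClosed S} (η : Congruence (A.subalg S hS))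

theorem Congruence.lift_refl {x : A.carrier} (hx : x ∈ S) : η.lift x x := ⟨hx, hx, η.refl _⟩

variable {η}

theorem Congruence.lift_symm {x y : A.carrier} (h : η.lift x y) : η.lift y x :=
  ⟨h.2.1, h.1, η.symm h.2.2⟩

theorem Congruence.lift_trans {x y z : A.carrier} (h : η.lift x y) (h' : η.lift y z) :
    η.lift x z :=
  ⟨h.1, h'.2.1, η.trans h.2.2 h'.2.2⟩

variable (η)

theorem Congruence.lift_invariant : A.Invariant η.lift := fun f x y h =>
  ⟨hS f x fun j => (h j).1, hS f y fun j => (h j).2.1,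
    η.compat f (fun j => ⟨x j, (h j).1⟩) (fun j => ⟨y j, (h j).2.1⟩) fun j => (h j).2.2⟩

theorem Congruence.mk_eq_mk_iff (x y : (A.subalg S hS).carrier) :
    Quotient.mk η.toSetoid x = Quotient.mk η.toSetoid y ↔ η.lift x.1 y.1 :=
  ⟨fun h => ⟨x.2, y.2, Quotient.exact h⟩, fun h => Quotient.sound (s := η.toSetoid) h.2.2⟩

theorem Congruence.eval_quot_two (t : Term σ 2) (x y : (A.subalg S hS).carrier) :
    ∃ w : (A.subalg S hS).carrier, w.1 = t.eval A ![x.1, y.1] ∧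
      t.eval ((A.subalg S hS).quot η) ![Quotient.mk η.toSetoid x, Quotient.mk η.toSetoid y] =
        Quotient.mk η.toSetoid w := by
  refine ⟨t.eval _ ![x, y], ?_, ?_⟩
  · rw [eval_subalg]
    congr 1; ext i; fin_cases i <;> rfl
  · rw [← eval_quot]
    congr 1; ext i; fin_cases i <;> rfl

theorem Congruence.eval_quot_three (t : Term σ 3) (x y z : (A.subalg S hS).carrier) :
    ∃ w : (A.subalg S hS).carrier, w.1 = t.eval A ![x.1, y.1, z.1] ∧
      t.eval ((A.subalg S hS).quot η) ![Quotient.mk η.toSetoid x, Quotient.mk η.toSetoid y,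
        Quotient.mk η.toSetoid z] = Quotient.mk η.toSetoid w := by
  refine ⟨t.eval _ ![x, y, z], ?_, ?_⟩
  · rw [eval_subalg]
    congr 1; ext i; fin_cases i <;> rfl
  · rw [← eval_quot]
    congr 1; ext i; fin_cases i <;> rfl

end lift

theorem Congruence.isFull_of_lift (hid : A.Idempotent) {z v : A.carrier}
    (η : Congruence (A.Sg {z, v})) (h : η.lift z v) : η.IsFull := by
  have key : ∀ x : (A.Sg {z, v}).carrier, η.lift x.1 z := by
    intro x
    obtain ⟨q, hq, hx⟩ := mem_closureSet_pair.mp x.2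
    rw [← hx]
    have := η.lift_invariant.op2 hq (η.lift_refl (mem_closureSet_left z v)) (η.lift_symm h)
    rwa [hq.idem hid] at this
  intro x y
  exact (Congruence.lift_trans (key x) (Congruence.lift_symm (key y))).2.2

/-- In a smooth majority free algebra, a term acting as a majority operation on two classes of a
maximal congruence yields a commutative pair in their union. -/
theorem exists_comm_of_majority (hid : A.Idempotent) (hsm : A.IsSmooth) (hmf : A.MajorityFree)
    {z v : A.carrier} {η : Congruence (A.Sg {z, v})} (hη : η.IsMaximal)
    {p : A.carrier → A.carrier → A.carrier → A.carrier} (hp : A.Op3 p)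
    (h1 : η.lift (p z z v) z) (h2 : η.lift (p z v z) z) (h3 : η.lift (p v z z) z)
    (h4 : η.lift (p v v z) v) (h5 : η.lift (p v z v) v) (h6 : η.lift (p z v v) v) :
    ∃ q, A.Op2 q ∧ η.lift (q z v) (q v z) ∧ (η.lift (q z v) z ∨ η.lift (q z v) v) := by
  have hzv : z ≠ v := by
    intro h
    exact hη.1 (η.isFull_of_lift hid (h ▸ η.lift_refl (mem_closureSet_left z v)))
  by_cases hsl : ∃ t : Term σ 2,
      IsSemilatticeOn (fun x y => t.eval ((A.Sg {z, v}).quot η) ![x, y])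
        {A.qa z v η, A.qb z v η}
  · obtain ⟨t, ht⟩ := id hsl
    have hcl := hsm z v η (Or.inl ⟨hη, hsl⟩)
    have hz : z ∈ A.edgeBlockUnion z v η := ⟨mem_closureSet_left z v, Or.inl (η.refl _)⟩
    have hv : v ∈ A.edgeBlockUnion z v η := ⟨mem_closureSet_right z v, Or.inr (η.refl _)⟩
    refine ⟨_, op2_of_term t, ?_, ?_⟩
    · have hc := ht.2.1 (A.qa z v η) (by simp) (A.qb z v η) (by simp)
      obtain ⟨w, hw, hw'⟩ := η.eval_quot_two t (A.sgA z v) (A.sgB z v)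
      obtain ⟨u, hu, hu'⟩ := η.eval_quot_two t (A.sgB z v) (A.sgA z v)
      have := (η.mk_eq_mk_iff w u).mp (hw'.symm.trans (hc.trans hu'))
      rwa [hw, hu] at this
    · obtain ⟨hx, h | h⟩ := hcl.op2 (op2_of_term t) hz hv
      · exact Or.inl ⟨_, _, h⟩
      · exact Or.inr ⟨_, _, h⟩
  · exfalso
    refine hmf z v ⟨hzv, η, hη, ?_, hsl⟩
    obtain ⟨t, ht⟩ := hp.exists_eval
    have key : ∀ x y w u : (A.Sg {z, v}).carrier, η.lift (p x.1 y.1 w.1) u.1 →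
        t.eval ((A.Sg {z, v}).quot η) ![Quotient.mk η.toSetoid x, Quotient.mk η.toSetoid y,
          Quotient.mk η.toSetoid w] = Quotient.mk η.toSetoid u := by
      intro x y w u h
      obtain ⟨c, hc, hc'⟩ := η.eval_quot_three t x y w
      refine hc'.trans ((η.mk_eq_mk_iff c u).mpr ?_)
      rwa [hc, ht]
    have hzz : η.lift (p z z z) z := by
      rw [hp.idem hid]; exact η.lift_refl (mem_closureSet_left z v)
    have hvv : η.lift (p v v v) v := by
      rw [hp.idem hid]; exact η.lift_refl (mem_closureSet_right z v)
    refine ⟨t, ?_⟩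
    rintro x (rfl | rfl) y (rfl | rfl)
    · exact ⟨key _ _ _ _ hzz, key _ _ _ _ hzz, key _ _ _ _ hzz⟩
    · exact ⟨key _ _ _ _ h1, key _ _ _ _ h2, key _ _ _ _ h3⟩
    · exact ⟨key _ _ _ _ h4, key _ _ _ _ h5, key _ _ _ _ h6⟩
    · exact ⟨key _ _ _ _ hvv, key _ _ _ _ hvv, key _ _ _ _ hvv⟩

/-- An algebra omitting type 1 has no two-class predicate on a two-generated subalgebra on which
all term operations act as projections. -/
theorem OmitsType1.exists_not_projection (h1 : A.OmitsType1) {z v : A.carrier}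
    {α : A.carrier → Prop} (hz : α z) (hv : ¬ α v) :
    ∃ (n : ℕ) (g : (Fin n → A.carrier) → A.carrier), A.TermOp g ∧
      ∀ i, ∃ x : Fin n → A.carrier, (∀ j, x j ∈ A.ClosureSet {z, v}) ∧
        ¬ (α (g x) ↔ α (x i)) := by
  by_contra! hpr
  have hU : A.IsClosed Set.univ := fun _ _ _ => trivial
  set B := A.subalg Set.univ hU with hB
  let z' : B.carrier := ⟨z, trivial⟩
  let v' : B.carrier := ⟨v, trivial⟩
  have hcl : ∀ x : (B.Sg {z', v'}).carrier, x.1.1 ∈ A.ClosureSet {z, v} := by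
    intro x
    have hsub : B.IsClosed {y | y.1 ∈ A.ClosureSet {z, v}} := fun f y hy =>
      A.closureSet_isClosed {z, v} f _ hy
    refine closureSet_subset hsub ?_ x.2
    rintro y (rfl | rfl)
    · exact mem_closureSet_left z v
    · exact mem_closureSet_right z v
  let θ : Congruence (B.Sg {z', v'}) :=
    { rel := fun x y => α x.1.1 ↔ α y.1.1
      refl := fun x => Iff.rfl
      symm := fun h => h.symm
      trans := fun h h' => h.trans h'
      compat := by
        intro f x y h
        obtain ⟨i, hi⟩ := hpr _ (A.interp f) (TermOp.basic f)
        exact (hi _ fun j => hcl (x j)).trans ((h i).trans (hi _ fun j => hcl (y j)).symm) }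
  refine h1 Set.univ hU z' v' ⟨?_, θ, ⟨?_, ?_⟩, ?_⟩
  · intro h
    have h : z = v := congrArg Subtype.val h
    exact hv (h ▸ hz)
  · intro h
    exact hv ((h (B.sgA z' v') (B.sgB z' v')).mp hz)
  · intro η hle hη x y hxy
    by_contra hne
    apply hη
    have key : ∀ w, η.rel w x := by
      intro w
      by_cases hw : θ.rel w x
      · exact hle _ _ hw
      · have : θ.rel w y := by
          change ¬ (α w.1.1 ↔ α x.1.1) at hw
          change ¬ (α x.1.1 ↔ α y.1.1) at hne
          change α w.1.1 ↔ α y.1.1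
          tauto
        exact η.trans (hle _ _ this) (η.symm hxy)
    exact fun w w' => η.trans (key w) (η.symm (key w'))
  · intro n t
    obtain ⟨i, hi⟩ := hpr n (t.eval A) ⟨t, fun _ => rfl⟩
    refine ⟨i, fun x => ?_⟩
    have hx : x = fun i => Quotient.mk θ.toSetoid (x i).out := by
      ext i; exact (Quotient.out_eq (x i)).symm
    rw [hx]
    rw [eval_quot]
    refine Quotient.sound (s := θ.toSetoid) ?_
    have h2 := hi (fun j => ((x j).out : (B.Sg {z', v'}).carrier).1.1) fun j => hcl _
    change α _ ↔ α _
    rw [← h2]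
    have e : ∀ y : Fin n → (B.Sg {z', v'}).carrier,
        (t.eval (B.Sg {z', v'}) y).1.1 = t.eval A fun j => (y j).1.1 := by
      intro y
      exact (congrArg Subtype.val (eval_subalg (A := B) _ t y)).trans (eval_subalg hU t _)
    rw [e]

end UAlgebra

namespace UAlgebra

variable {σ : Signature} {A : UAlgebra σ}

/-- The `R`-neighbours of `c` inside `K` all belong to `N`. -/
def Near (A : UAlgebra σ) (R : A.carrier → A.carrier → Prop) (K N : Set A.carrier)
    (c : A.carrier) : Prop :=
  ∀ k ∈ K, R c k → k ∈ N

/-- A pair `z`, `v` for which no binary term operation moves `z` above its neighbourhood `N`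
symmetrically. -/
structure BadPair (A : UAlgebra σ) (z v : A.carrier) (R : A.carrier → A.carrier → Prop)
    (K N W : Set A.carrier) (F : A.carrier → A.carrier → A.carrier) : Prop where
  inv : A.Invariant R
  closed : A.IsClosed K
  sub : N ⊆ K
  rel_left : ∀ k ∈ N, R z k
  near_left : A.Near R K N z
  rel_right : ∀ k ∈ K, R v k
  rel_top : ∀ w ∈ W, ∀ k ∈ K, R w k
  mem_top : v ∈ W
  ne : ∃ k ∈ K, k ∉ N
  no_absorb : ∀ q, A.Op2 q → (∀ n ∈ N, ∀ k ∈ K, q n k ∈ N) → ¬ ∀ n ∈ N, ∀ k ∈ K, q k n ∈ N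
  op : A.Op2 F
  op_left : ∀ n ∈ N, ∀ k ∈ K, F n k ∈ N
  op_top : ∀ c, ¬ A.Near R K N c → c ∈ A.ClosureSet {z, v} → ∀ w ∈ W, F c w ∈ W ∧ F w c ∈ W
  op_right_left : F v z ∈ W
  no_both : ∀ q, A.Op2 q → q z v ∈ W → q v z ∉ W

/-- Pairs of values of a binary term operation at `(z, v)` and `(v, z)`. -/
def SwapPair (A : UAlgebra σ) (z v s t : A.carrier) : Prop :=
  ∃ q, A.Op2 q ∧ q z v = s ∧ q v z = t

namespace SwapPair

variable {z v : A.carrier}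

theorem base : A.SwapPair z v z v := ⟨_, op2_fst, rfl, rfl⟩

theorem symm {s t : A.carrier} (h : A.SwapPair z v s t) : A.SwapPair z v t s :=
  let ⟨_, hq, h1, h2⟩ := h; ⟨_, hq.flip, h2, h1⟩

theorem mem {s t : A.carrier} (h : A.SwapPair z v s t) : s ∈ A.ClosureSet {z, v} :=
  let ⟨q, hq, h1, _⟩ := h; mem_closureSet_pair.mpr ⟨q, hq, h1⟩

theorem invariant : A.Invariant (A.SwapPair z v) := by
  intro f x y h
  choose q hq h1 h2 using h
  exact ⟨fun a b => A.interp f fun j => q j a b, TermOp.comp (TermOp.basic f) hq,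
    by simp only [h1], by simp only [h2]⟩

end SwapPair

namespace BadPair

variable {z v : A.carrier} {R : A.carrier → A.carrier → Prop} {K N W : Set A.carrier}
  {F : A.carrier → A.carrier → A.carrier}

theorem not_near_top (h : A.BadPair z v R K N W F) {w : A.carrier} (hw : w ∈ W) :
    ¬ A.Near R K N w := fun hn =>
  let ⟨k, hk, hkN⟩ := h.ne
  hkN (hn k hk (h.rel_top w hw k hk))

theorem near_termOp (h : A.BadPair z v R K N W F) {n : ℕ}
    {g : (Fin n → A.carrier) → A.carrier} (hg : A.TermOp g) {x y : Fin n → A.carrier}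
    (hn : A.Near R K N (g x)) (hy : ∀ i, y i ∈ K) (hxy : ∀ i, R (x i) (y i)) : g y ∈ N :=
  hn _ (h.closed.termOp hg hy) (h.inv.termOp hg hxy)

theorem near_op2 (h : A.BadPair z v R K N W F) {g : A.carrier → A.carrier → A.carrier}
    (hg : A.Op2 g) {x y x' y' : A.carrier} (hn : A.Near R K N (g x y))
    (hx' : x' ∈ K) (hy' : y' ∈ K) (hx : R x x') (hy : R y y') : g x' y' ∈ N :=
  hn _ (h.closed.op2 hg hx' hy') (h.inv.op2 hg hx hy)

theorem near_op3 (h : A.BadPair z v R K N W F)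
    {g : A.carrier → A.carrier → A.carrier → A.carrier}
    (hg : A.Op3 g) {x y w x' y' w' : A.carrier} (hn : A.Near R K N (g x y w))
    (hx' : x' ∈ K) (hy' : y' ∈ K) (hw' : w' ∈ K) (hx : R x x') (hy : R y y') (hw : R w w') :
    g x' y' w' ∈ N :=
  hn _ (h.closed.op3 hg hx' hy' hw') (h.inv.op3 hg hx hy hw)

theorem rel_of_mem (h : A.BadPair z v R K N W F) (hid : A.Idempotent) {c : A.carrier}
    (hc : c ∈ A.ClosureSet {z, v}) {n : A.carrier} (hn : n ∈ N) : R c n := by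
  obtain ⟨q, hq, rfl⟩ := mem_closureSet_pair.mp hc
  have := h.inv.op2 hq (h.rel_left n hn) (h.rel_right n (h.sub hn))
  rwa [hq.idem hid] at this

theorem absorb_left (h : A.BadPair z v R K N W F) {q : A.carrier → A.carrier → A.carrier}
    (hq : A.Op2 q) (hn : A.Near R K N (q z v)) : ∀ n ∈ N, ∀ k ∈ K, q n k ∈ N :=
  fun n hn' k hk => h.near_op2 hq hn (h.sub hn') hk (h.rel_left n hn') (h.rel_right k hk)

theorem not_near_swap_of_absorb (h : A.BadPair z v R K N W F)
    {q : A.carrier → A.carrier → A.carrier}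
    (hq : A.Op2 q) (hn : ∀ n ∈ N, ∀ k ∈ K, q n k ∈ N) : ¬ A.Near R K N (q v z) :=
  fun hv => h.no_absorb q hq hn (h.absorb_left hq.flip hv)

theorem not_near_swap (h : A.BadPair z v R K N W F) {s t : A.carrier}
    (hst : A.SwapPair z v s t) (hs : A.Near R K N s) : ¬ A.Near R K N t := by
  obtain ⟨q, hq, rfl, rfl⟩ := hst
  exact h.not_near_swap_of_absorb hq (h.absorb_left hq hs)

theorem near_of_swap_mem (h : A.BadPair z v R K N W F) {s t : A.carrier}
    (hst : A.SwapPair z v s t) (ht : t ∈ W) : A.Near R K N s := by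
  by_contra hs
  obtain ⟨hF1, hF2⟩ := h.op_top s hs hst.mem t ht
  obtain ⟨q, hq, rfl, rfl⟩ := hst
  exact h.no_both _ (h.op.comp2 hq hq.flip) hF1 hF2

theorem fold (h : A.BadPair z v R K N W F) {s t s' t' : A.carrier}
    (hst : A.SwapPair z v s t) (ht : ¬ A.Near R K N t) (hst' : A.SwapPair z v s' t')
    (ht' : t' ∈ W) : (A.SwapPair z v (F s s') (F t t') ∧ F t t' ∈ W) ∧
      A.SwapPair z v (F s' s) (F t' t) ∧ F t' t ∈ W := by
  obtain ⟨h1, h2⟩ := h.op_top t ht hst.symm.mem t' ht'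
  exact ⟨⟨SwapPair.invariant.op2 h.op hst hst', h1⟩, SwapPair.invariant.op2 h.op hst' hst, h2⟩

/-- If `t` is not near, then `F s z` is near. -/
theorem near_fold (h : A.BadPair z v R K N W F) {s t : A.carrier}
    (hst : A.SwapPair z v s t) (ht : ¬ A.Near R K N t) : A.Near R K N (F s z) :=
  have := (h.fold hst ht SwapPair.base h.mem_top).1
  h.near_of_swap_mem this.1 this.2

theorem near_of_top_right (h : A.BadPair z v R K N W F) (hid : A.Idempotent)
    {g : A.carrier → A.carrier → A.carrier → A.carrier} (hg : A.Op3 g) {u s' u' : A.carrier}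
    (hu : u ∈ W) (hst' : A.SwapPair z v s' u')
    (hn : A.Near R K N (g u z v)) : A.Near R K N (g u' z v) := by
  by_contra hc
  have hF := h.near_fold (SwapPair.invariant.op3 hg hst' SwapPair.base.symm SwapPair.base) hc
  have hop : A.Op2 fun x y => F (g x y x) x :=
    h.op.comp (hg.comp (TermOp.proj 0) (TermOp.proj 1) (TermOp.proj 0)) (TermOp.proj 0)
  refine h.no_absorb _ hop (fun n hn' k hk => ?_) (fun n hn' k hk => ?_)
  · have hop4 : A.TermOp fun x : Fin 4 → A.carrier => F (g (x 0) (x 1) (x 2)) (x 3) :=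
      h.op.comp (hg.comp (TermOp.proj 0) (TermOp.proj 1) (TermOp.proj 2)) (TermOp.proj 3)
    refine h.near_termOp (x := ![s', v, z, z]) (y := ![n, k, n, n]) hop4 hF ?_ ?_
    · intro i; fin_cases i <;> simp [h.sub hn', hk]
    · intro i; fin_cases i
      · exact h.rel_of_mem hid hst'.mem hn'
      · exact h.rel_right k hk
      · exact h.rel_left n hn'
      · exact h.rel_left n hn'
  · exact h.op_left _ (h.near_op3 hg hn hk (h.sub hn') hk (h.rel_top u hu k hk)
      (h.rel_left n hn') (h.rel_right k hk)) k hk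

theorem near_of_top_left (h : A.BadPair z v R K N W F) (hid : A.Idempotent)
    {g : A.carrier → A.carrier → A.carrier → A.carrier} (hg : A.Op3 g) {s u s' u' : A.carrier}
    (hst : A.SwapPair z v s u) (hst' : A.SwapPair z v s' u') (hu' : u' ∈ W)
    (hn : A.Near R K N (g s z v)) : A.Near R K N (g s' z v) := by
  by_contra hc
  have hF := h.near_fold
    (SwapPair.invariant.op3 hg hst'.symm SwapPair.base.symm SwapPair.base) hc
  have hop : A.Op2 fun x y => F (g x x y) y :=
    h.op.comp (hg.comp (TermOp.proj 0) (TermOp.proj 0) (TermOp.proj 1)) (TermOp.proj 1)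
  refine h.no_absorb _ hop (fun n hn' k hk => ?_) (fun n hn' k hk => ?_)
  · exact h.op_left _ (h.near_op3 hg hn (h.sub hn') (h.sub hn') hk
      (h.rel_of_mem hid hst.mem hn') (h.rel_left n hn') (h.rel_right k hk)) k hk
  · have hop4 : A.TermOp fun x : Fin 4 → A.carrier => F (g (x 0) (x 1) (x 2)) (x 3) :=
      h.op.comp (hg.comp (TermOp.proj 0) (TermOp.proj 1) (TermOp.proj 2)) (TermOp.proj 3)
    refine h.near_termOp (x := ![u', v, z, z]) (y := ![k, k, n, n]) hop4 hF ?_ ?_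
    · intro i; fin_cases i <;> simp [h.sub hn', hk]
    · intro i; fin_cases i
      · exact h.rel_top u' hu' k hk
      · exact h.rel_right k hk
      · exact h.rel_left n hn'
      · exact h.rel_left n hn'

/-- Indistinguishability by `Near` under unary polynomials. -/
def NearEquiv (A : UAlgebra σ) (z v : A.carrier) (R : A.carrier → A.carrier → Prop)
    (K N : Set A.carrier) (x y : A.carrier) : Prop :=
  ∀ g, A.Op3 g → (A.Near R K N (g x z v) ↔ A.Near R K N (g y z v))

theorem nearEquiv_compat (f : σ.ops) (x y : Fin (σ.arity f) → A.carrier)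
    (hx : ∀ i, x i ∈ A.ClosureSet {z, v}) (hy : ∀ i, y i ∈ A.ClosureSet {z, v})
    (hxy : ∀ i, NearEquiv A z v R K N (x i) (y i)) :
    NearEquiv A z v R K N (A.interp f x) (A.interp f y) := by
  classical
  have step : ∀ s : Finset (Fin (σ.arity f)),
      NearEquiv A z v R K N (A.interp f x) (A.interp f (s.piecewise y x)) := by
    intro s
    induction s using Finset.induction_on with
    | empty => intro g _; simp
    | insert i s hi ih =>
      intro g hg
      refine (ih g hg).trans ?_
      have hmem : ∀ j, ∃ q, A.Op2 q ∧ q z v = s.piecewise y x j := by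
        intro j
        apply mem_closureSet_pair.mp
        by_cases hj : j ∈ s
        · rw [Finset.piecewise_eq_of_mem _ _ _ hj]; exact hy j
        · rw [Finset.piecewise_eq_of_notMem _ _ _ hj]; exact hx j
      choose q hq hqv using hmem
      have hop : A.Op3 fun a b c => g (A.interp f fun j => if j = i then a else q j b c) b c := by
        refine hg.comp (TermOp.comp (TermOp.basic f) fun j => ?_) (TermOp.proj 1) (TermOp.proj 2)
        by_cases hj : j = i
        · simp only [hj, if_true]; exact TermOp.proj 0
        · simp only [hj, if_false]; exact (hq j).comp (TermOp.proj 1) (TermOp.proj 2)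
      have := hxy i _ hop
      have e1 : (fun j => if j = i then x i else q j z v) = s.piecewise y x := by
        ext j
        by_cases hj : j = i
        · subst hj; simp [hi]
        · simp [hj, hqv]
      have e2 : (fun j => if j = i then y i else q j z v) = (insert i s).piecewise y x := by
        ext j
        by_cases hj : j = i
        · subst hj; simp
        · simp [hj, hqv, Finset.piecewise, Finset.mem_insert]
      simpa only [e1, e2] using this
  simpa using step Finset.univ

theorem exists_congruence [Finite A.carrier] (h : A.BadPair z v R K N W F)
    (hid : A.Idempotent) :
    ∃ η : Congruence (A.Sg {z, v}), η.IsMaximal ∧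
      ∀ s t, A.SwapPair z v s t → t ∈ W → η.lift s z ∧ η.lift t v := by
  let ρ : Congruence (A.Sg {z, v}) :=
    { rel := fun x y => NearEquiv A z v R K N x.1 y.1
      refl := fun x g _ => Iff.rfl
      symm := fun h g hg => (h g hg).symm
      trans := fun h h' g hg => (h g hg).trans (h' g hg)
      compat := fun f x y hxy => nearEquiv_compat f _ _ (fun j => (x j).2) (fun j => (y j).2) hxy }
  have hρ : ¬ ρ.IsFull := fun hf =>
    h.not_near_top h.mem_top ((hf (A.sgA z v) (A.sgB z v) (fun x _ _ => x) (TermOp.proj 0)).mp h.near_left)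
  have : Finite (A.Sg {z, v}).carrier :=
    inferInstanceAs (Finite {x : A.carrier // x ∈ A.ClosureSet {z, v}})
  obtain ⟨η, hη, hle⟩ := ρ.exists_isMaximal hρ
  refine ⟨η, hη, fun s t hst ht => ⟨?_, ?_⟩⟩
  · refine ⟨hst.mem, mem_closureSet_left z v, hle _ _ fun g hg => ⟨?_, ?_⟩⟩
    · exact h.near_of_top_left hid hg hst SwapPair.base h.mem_top
    · exact h.near_of_top_left hid hg SwapPair.base hst ht
  · refine ⟨hst.symm.mem, mem_closureSet_right z v, hle _ _ fun g hg => ⟨?_, ?_⟩⟩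
    · exact h.near_of_top_right hid hg ht SwapPair.base
    · exact h.near_of_top_right hid hg h.mem_top hst

/-- No ternary term operation behaves like a majority operation modulo `W`. -/
theorem no_majority [Finite A.carrier] (h : A.BadPair z v R K N W F) (hid : A.Idempotent)
    (hsm : A.IsSmooth) (hmf : A.MajorityFree)
    {p : A.carrier → A.carrier → A.carrier → A.carrier} (hp : A.Op3 p)
    (h1 : p v v z ∈ W) (h2 : p v z v ∈ W) (h3 : p z v v ∈ W) : False := by
  obtain ⟨η, hη, hE⟩ := h.exists_congruence hid
  have sw : A.SwapPair z v z v := SwapPair.base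
  have hp1 := hE _ _ (SwapPair.invariant.op3 hp sw sw sw.symm) h1
  have hp2 := hE _ _ (SwapPair.invariant.op3 hp sw sw.symm sw) h2
  have hp3 := hE _ _ (SwapPair.invariant.op3 hp sw.symm sw sw) h3
  have hzv : ¬ η.lift z v := fun hl => hη.1 (η.isFull_of_lift hid hl)
  have hF := hE _ _ (SwapPair.invariant.op2 h.op sw sw.symm) h.op_right_left
  have rz : η.lift z z := η.lift_refl (mem_closureSet_left z v)
  have rv : η.lift v v := η.lift_refl (mem_closureSet_right z v)
  have aux : ∀ c c', A.SwapPair z v c c' → ¬ A.Near R K N c → η.lift c c' →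
      (η.lift c z ∨ η.lift c v) → False := by
    intro c c' hcc hc hl hor
    have hfold := (h.fold hcc.symm hc sw h.mem_top).1
    have hG := hE _ _ hfold.1 hfold.2
    rcases hor with hcz | hcv
    · have := η.lift_invariant.op2 h.op hcz rv
      exact hzv (Congruence.lift_trans (Congruence.lift_symm hF.1)
        (Congruence.lift_trans (Congruence.lift_symm this) hG.2))
    · have := η.lift_invariant.op2 h.op (Congruence.lift_trans (Congruence.lift_symm hl) hcv) rz
      exact hzv (Congruence.lift_trans (Congruence.lift_symm hG.1) (Congruence.lift_trans this hF.2))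
  obtain ⟨q, hq, hc, hor⟩ := exists_comm_of_majority hid hsm hmf hη hp hp1.1 hp2.1 hp3.1
    hp1.2 hp2.2 hp3.2
  have hsw : A.SwapPair z v (q z v) (q v z) := ⟨q, hq, rfl, rfl⟩
  by_cases hn : A.Near R K N (q z v)
  · refine aux _ _ hsw.symm (h.not_near_swap hsw hn) (Congruence.lift_symm hc) ?_
    exact hor.imp (Congruence.lift_trans (Congruence.lift_symm hc))
      (Congruence.lift_trans (Congruence.lift_symm hc))
  · exact aux _ _ hsw hn hc hor

/-- There are no bad pairs in a smooth majority free algebra omitting type 1. -/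
theorem elim [Finite A.carrier] (h : A.BadPair z v R K N W F) (hid : A.Idempotent)
    (hsm : A.IsSmooth) (h1 : A.OmitsType1) (hmf : A.MajorityFree) : False := by
  classical
  have sw : A.SwapPair z v z v := SwapPair.base
  have hv : ¬ A.Near R K N v := h.not_near_top h.mem_top
  have hFmem : ∀ {c c'}, A.SwapPair z v c c' → ¬ A.Near R K N c' → F c' v ∈ W := fun hcc hc =>
    (h.fold hcc hc sw h.mem_top).1.2
  by_cases hk : ∃ k, A.Op2 k ∧ ¬ A.Near R K N (k z v) ∧ ¬ A.Near R K N (k v z)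
  · obtain ⟨k, hk, hk1, hk2⟩ := hk
    have hop : A.Op3 fun x y w => F (k x y) w :=
      h.op.comp (hk.comp (TermOp.proj 0) (TermOp.proj 1)) (TermOp.proj 2)
    have hs : A.SwapPair z v (k z v) (k v z) := ⟨k, hk, rfl, rfl⟩
    refine h.no_majority hid hsm hmf hop ?_ (hFmem hs hk2) (hFmem hs.symm hk1)
    simp only [hk.idem hid]
    exact h.op_right_left
  push Not at hk
  have near_left : ∀ q, A.Op2 q → (∀ n ∈ N, ∀ k ∈ K, q n k ∈ N) → A.Near R K N (q z v) := by
    intro q hq hn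
    by_contra hc
    exact h.not_near_swap_of_absorb hq hn (hk q hq hc)
  obtain ⟨n, g, hg, hgp⟩ := h1.exists_not_projection (α := A.Near R K N) h.near_left hv
  let I : Finset (Fin n) → A.carrier → A.carrier → A.carrier := fun s x y =>
    g fun i => if i ∈ s then x else y
  have hI : ∀ s, A.Op2 (I s) := by
    intro s
    refine TermOp.comp hg fun i => ?_
    by_cases hi : i ∈ s
    · simp only [hi, if_true]; exact TermOp.proj 0
    · simp only [hi, if_false]; exact TermOp.proj 1
  have habs : ∀ s, A.Near R K N (I s z v) → ∀ y : Fin n → A.carrier, (∀ i, y i ∈ K) →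
      (∀ i ∈ s, y i ∈ N) → g y ∈ N := by
    intro s hs y hy hy'
    refine h.near_termOp hg hs hy fun i => ?_
    by_cases hi : i ∈ s
    · simp only [hi, if_true]; exact h.rel_left _ (hy' i hi)
    · simp only [hi, if_false]; exact h.rel_right _ (hy i)
  by_cases hinter : ∀ s t, A.Near R K N (I s z v) → A.Near R K N (I t z v) →
      A.Near R K N (I (s ∩ t) z v)
  · have hsing : ∃ i, A.Near R K N (I {i} z v) := by
      by_contra! hno
      have hcompl : ∀ i, A.Near R K N (I {i}ᶜ z v) := by
        intro i
        have := hk _ (hI {i}) (hno i)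
        have e : I {i}ᶜ z v = I {i} v z := by
          refine congrArg g ?_
          ext j
          by_cases hj : j = i <;> simp [hj]
        rwa [e]
      have : ∀ s : Finset (Fin n), A.Near R K N (I sᶜ z v) := by
        intro s
        induction s using Finset.induction_on with
        | empty =>
          have : I ∅ᶜ z v = z := by
            simp only [I, Finset.compl_empty, Finset.mem_univ, if_true]
            exact hg.idem hid z
          rw [this]; exact h.near_left
        | insert i s hi ih =>
          have e : (insert i s)ᶜ = {i}ᶜ ∩ sᶜ := by ext j; simp
          rw [e]
          exact hinter _ _ (hcompl i) ih
      have hun := this Finset.univ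
      have e : I Finset.univᶜ z v = v := by
        simp only [I, Finset.compl_univ, Finset.notMem_empty, if_false]
        exact hg.idem hid v
      rw [e] at hun
      exact hv hun
    obtain ⟨i, hi⟩ := hsing
    obtain ⟨x, hx, hxi⟩ := hgp i
    apply hxi
    have hq : ∀ j, ∃ q, A.Op2 q ∧ q z v = x j := fun j => mem_closureSet_pair.mp (hx j)
    choose q hq hqx using hq
    have hc : A.Op2 fun a b => g fun j => q j a b := TermOp.comp hg hq
    have hgx : (g fun j => q j z v) = g x := by simp only [hqx]
    have key : ∀ (q : Fin n → A.carrier → A.carrier → A.carrier), (∀ j, A.Op2 (q j)) →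
        A.Near R K N (q i z v) → A.Near R K N (g fun j => q j z v) := by
      intro q hq hqi
      refine near_left (fun a b => g fun j => q j a b) (TermOp.comp hg hq) fun m hm k hk' => ?_
      refine habs {i} hi _ (fun j => h.closed.op2 (hq j) (h.sub hm) hk') fun j hj => ?_
      rw [Finset.mem_singleton] at hj
      subst hj
      exact h.absorb_left (hq j) hqi m hm k hk'
    constructor
    · intro hn
      by_contra hni
      rw [← hqx] at hni
      have h2 := key (fun j a b => q j b a) (fun j => (hq j).flip) (hk _ (hq i) hni)
      have hs : A.SwapPair z v (g x) (g fun j => q j v z) := ⟨_, hc, hgx, rfl⟩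
      exact h.not_near_swap hs hn h2
    · intro hn
      rw [← hqx] at hn
      rw [← hgx]
      exact key q hq hn
  · push Not at hinter
    obtain ⟨s, t, hs, ht, hst⟩ := hinter
    let p : A.carrier → A.carrier → A.carrier → A.carrier := fun x y w =>
      g fun i => if i ∈ s then if i ∈ t then x else y else w
    have hp : A.Op3 p := by
      refine TermOp.comp hg fun i => ?_
      split_ifs
      · exact TermOp.proj 0
      · exact TermOp.proj 1
      · exact TermOp.proj 2
    have hp1 : A.Near R K N (p z z v) := by
      convert hs using 2
      refine congrArg g ?_
      ext i; split_ifs <;> rfl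
    have hp3 : A.Near R K N (p v z z) := by
      convert hk _ (hI (s ∩ t)) hst using 2
      refine congrArg g ?_
      ext i
      by_cases h1 : i ∈ s <;> by_cases h2 : i ∈ t <;> simp [h1, h2]
    have hp2 : A.Near R K N (p z v z) := by
      refine near_left (fun a b => p a b a)
        (hp.comp (TermOp.proj 0) (TermOp.proj 1) (TermOp.proj 0)) fun m hm k hk' => ?_
      refine habs t ht _ (fun i => ?_) fun i hi => ?_
      · split_ifs
        exacts [h.sub hm, hk', h.sub hm]
      · simp only [hi, if_true]
        split_ifs <;> exact hm
    have hsw : ∀ c c', A.SwapPair z v c c' → A.Near R K N c → ¬ A.Near R K N (F c' z) := by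
      rintro c c' ⟨q, hq, rfl, rfl⟩ hc
      refine h.not_near_swap_of_absorb (q := fun a b => F (q a b) b)
        (h.op.comp hq (TermOp.proj 1)) fun m hm k hk' => ?_
      exact h.op_left _ (h.absorb_left hq hc m hm k hk') k hk'
    have s1 := SwapPair.invariant.op3 hp sw sw sw.symm
    have s2 := SwapPair.invariant.op3 hp sw sw.symm sw
    have s3 := SwapPair.invariant.op3 hp sw.symm sw sw
    have cl : ∀ {c c'}, A.SwapPair z v c c' → F c' z ∈ A.ClosureSet {z, v} := fun hcc =>
      (A.closureSet_isClosed _).op2 h.op hcc.symm.mem (mem_closureSet_left z v)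
    have hop : A.Op3 fun x y w => F (F (p x y w) x) (F (p x y w) y) :=
      h.op.comp (h.op.comp hp (TermOp.proj 0)) (h.op.comp hp (TermOp.proj 1))
    refine h.no_majority hid hsm hmf hop ?_ ?_ ?_
    · simp only [h.op.idem hid]
      exact hFmem s1 (h.not_near_swap s1 hp1)
    · exact (h.op_top _ (hsw _ _ s2 hp2) (cl s2) _ (hFmem s2 (h.not_near_swap s2 hp2))).2
    · exact (h.op_top _ (hsw _ _ s3 hp3) (cl s3) _ (hFmem s3 (h.not_near_swap s3 hp3))).1

end BadPair

end UAlgebra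

namespace UAlgebra

variable {σ : Signature} {A : UAlgebra σ}

/-- The binary term operation `g` witnesses that `K` absorbs `D`. -/
def Absorbs (A : UAlgebra σ) (K D : Set A.carrier) (g : A.carrier → A.carrier → A.carrier) :
    Prop :=
  A.Op2 g ∧ ∀ k ∈ K, ∀ d ∈ D, g k d ∈ K ∧ g d k ∈ K

theorem Absorbs.flip {K D : Set A.carrier} {g : A.carrier → A.carrier → A.carrier}
    (h : A.Absorbs K D g) : A.Absorbs K D fun x y => g y x :=
  ⟨h.1.flip, fun k hk d hd => (h.2 k hk d hd).symm⟩

/-- If `K` absorbs `D` minimally, then the elements related to all of `K` absorb the elements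
related to some member of `K`. -/
theorem exists_absorbs_top [Finite A.carrier] (hid : A.Idempotent)
    (hsm : A.IsSmooth) (h1 : A.OmitsType1) (hmf : A.MajorityFree)
    {D K : Set A.carrier} {R : A.carrier → A.carrier → Prop}
    (hD : A.IsClosed D) (hK : A.IsClosed K) (hKD : K ⊆ D) (hKne : K.Nonempty)
    (hR : A.Invariant R) (hne : ∃ g, A.Absorbs K D g)
    (hmin : ∀ S ⊆ K, A.IsClosed S → S.Nonempty → ∀ g, A.Absorbs K D g → A.Absorbs S K g → S = K) :
    ∃ f, A.Absorbs K D f ∧ ∀ x ∈ D, (∃ k ∈ K, R x k) → ∀ w ∈ D, (∀ k ∈ K, R w k) →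
      (∀ k ∈ K, R (f x w) k) ∧ ∀ k ∈ K, R (f w x) k := by
  classical
  set X : Set A.carrier := {x | x ∈ D ∧ ∃ k ∈ K, R x k} with hX
  set W : Set A.carrier := {x | x ∈ D ∧ ∀ k ∈ K, R x k} with hW
  let Nb : A.carrier → Set A.carrier := fun x => {k | k ∈ K ∧ R x k}
  have hWX : W ⊆ X := fun w hw => ⟨hw.1, hKne.imp fun k hk => ⟨hk, hw.2 k hk⟩⟩
  have hWNb : ∀ w ∈ W, ∀ S ⊆ K, S ⊆ Nb w := fun w hw S hS k hk => ⟨hS hk, hw.2 k (hS hk)⟩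
  have hNbK : ∀ x, Nb x ⊆ K := fun x k hk => hk.1
  -- the neighbourhood of a value contains every common neighbourhood of the arguments
  have hNb2 : ∀ {q}, A.Op2 q → ∀ {x y : A.carrier} {S : Set A.carrier}, S ⊆ Nb x → S ⊆ Nb y →
      S ⊆ Nb (q x y) := by
    intro q hq x y S hx hy k hk
    refine ⟨(hx hk).1, ?_⟩
    have := hR.op2 hq (hx hk).2 (hy hk).2
    rwa [hq.idem hid] at this
  have hX2 : ∀ {q}, A.Op2 q → ∀ {x y}, x ∈ X → y ∈ X → ∀ {S : Set A.carrier}, S.Nonempty →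
      S ⊆ Nb x → S ⊆ Nb y → q x y ∈ X := fun {q} hq {x y} hx hy {S} hS hSx hSy =>
    ⟨hD.op2 hq hx.1 hy.1, hS.imp fun k hk => hNb2 hq hSx hSy hk⟩
  have hWW : ∀ {q}, A.Op2 q → ∀ {x y}, x ∈ W → y ∈ W → q x y ∈ W := fun {q} hq {x y} hx hy =>
    ⟨hD.op2 hq hx.1 hy.1, fun k hk =>
      (hNb2 hq (hWNb x hx K subset_rfl) (hWNb y hy K subset_rfl) hk).2⟩
  let good : Set (Set A.carrier) := {P | W ⊆ P ∧ P ⊆ X ∧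
    (∀ x ∈ P, ∀ x' ∈ X, Nb x ⊆ Nb x' → x' ∈ P) ∧
    ∃ f, A.Absorbs K D f ∧ ∀ p ∈ P, ∀ w ∈ W, f p w ∈ W ∧ f w p ∈ W}
  have hgoodW : W ∈ good := by
    obtain ⟨g, hg⟩ := hne
    refine ⟨subset_rfl, hWX, fun x hx x' hx' hsub => ⟨hx'.1, fun k hk => ?_⟩, g, hg, ?_⟩
    · exact (hsub (hWNb x hx K subset_rfl hk)).2
    · exact fun p hp w hw => ⟨hWW hg.1 hp hw, hWW hg.1 hw hp⟩
  obtain ⟨P, -, hPmax⟩ := good.toFinite.exists_le_maximal hgoodW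
  obtain ⟨hWP, hPX, hPup, f₀, hf₀, hf₀P⟩ := hPmax.prop
  by_cases hXP : X ⊆ P
  · exact ⟨f₀, hf₀, fun x hx hx' w hw hw' =>
      have := hf₀P x (hXP ⟨hx, hx'⟩) w ⟨hw, hw'⟩
      ⟨this.1.2, this.2.2⟩⟩
  exfalso
  obtain ⟨z₀, hz₀, hz₀max⟩ : ∃ z₀ ∈ X \ P, ∀ x ∈ X \ P, Nb z₀ ⊆ Nb x → Nb x ⊆ Nb z₀ := by
    obtain ⟨z, hzX, hzP⟩ := Set.not_subset.mp hXP
    obtain ⟨S, -, hS⟩ := (Nb '' (X \ P)).toFinite.exists_le_maximal ⟨z, ⟨hzX, hzP⟩, rfl⟩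
    obtain ⟨z₀, hz₀, rfl⟩ := hS.prop
    exact ⟨z₀, hz₀, fun x hx hsub => hS.le_of_ge ⟨x, hx, rfl⟩ hsub⟩
  obtain ⟨hz₀X, hz₀P⟩ := hz₀
  set N := Nb z₀ with hN
  have hNK : N ⊆ K := hNbK z₀
  have hNne : N.Nonempty := hz₀X.2.imp fun k hk => hk
  have hNproper : ∃ k ∈ K, k ∉ N := by
    by_contra! hall
    exact hz₀P (hWP ⟨hz₀X.1, fun k hk => (hall k hk).2⟩)
  have hNcl : A.IsClosed N := by
    intro f x hx
    refine ⟨hK f x fun j => (hx j).1, ?_⟩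
    have := hR f (fun _ => z₀) x fun j => (hx j).2
    rwa [hid] at this
  let α : Set A.carrier := {x | x ∈ X ∧ Nb x = N}
  have hsplit : ∀ x ∈ X, N ⊆ Nb x → x ∈ P ∨ x ∈ α := by
    intro x hx hsub
    by_cases hxP : x ∈ P
    · exact Or.inl hxP
    · exact Or.inr ⟨hx, (hz₀max x ⟨hx, hxP⟩ hsub).antisymm hsub⟩
  have hGN : ∀ f, A.Absorbs K D f → (∀ n ∈ N, ∀ k ∈ K, f n k ∈ N) →
      ¬ ∀ n ∈ N, ∀ k ∈ K, f k n ∈ N := by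
    intro f hf hf1 hf2
    obtain ⟨k, hk, hkN⟩ := hNproper
    have := hmin N hNK hNcl hNne f hf ⟨hf.1, fun n hn k hk => ⟨hf1 n hn k hk, hf2 n hn k hk⟩⟩
    exact hkN (this ▸ hk)
  -- a value at `α × W` outside `P` forces absorption of `N` on one side
  have hαW : ∀ {q}, A.Op2 q → (∃ z ∈ α, ∃ w ∈ W, q z w ∉ P) → ∀ n ∈ N, ∀ k ∈ K, q n k ∈ N := by
    rintro q hq ⟨z, hz, w, hw, hP⟩ n hn k hk
    have hsub : N ⊆ Nb (q z w) := hNb2 hq hz.2.ge (hWNb w hw N hNK)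
    have hqX := hX2 hq hz.1 (hWX hw) hNne hz.2.ge (hWNb w hw N hNK)
    have hα := (hsplit _ hqX hsub).resolve_left hP
    rw [← hα.2]
    exact ⟨hK.op2 hq (hNK hn) hk, hR.op2 hq (hz.2.ge hn).2 (hw.2 k hk)⟩
  obtain ⟨f, hf, hfP, hfα⟩ : ∃ f, A.Absorbs K D f ∧
      (∀ p ∈ P, ∀ w ∈ W, f p w ∈ W ∧ f w p ∈ W) ∧ ∀ z ∈ α, ∀ w ∈ W, f w z ∈ P := by
    by_cases hα1 : ∀ z ∈ α, ∀ w ∈ W, f₀ w z ∈ P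
    · exact ⟨f₀, hf₀, hf₀P, hα1⟩
    · refine ⟨fun x y => f₀ y x, hf₀.flip, fun p hp w hw => (hf₀P p hp w hw).symm, ?_⟩
      by_contra hα2
      push Not at hα1 hα2
      exact hGN f₀ hf₀ (hαW hf₀.1 hα2) (hαW hf₀.1.flip hα1)
  let 𝓕 : (A.carrier → A.carrier → A.carrier) → Prop := fun g => A.Absorbs K D g ∧
    (∀ p ∈ P, ∀ w ∈ W, g p w ∈ W ∧ g w p ∈ W) ∧ ∀ z ∈ α, ∀ w ∈ W, g w z ∈ W
  obtain ⟨F, hF⟩ : ∃ F, 𝓕 F := by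
    refine ⟨fun x y => f (f x y) x, ⟨hf.1.comp2 hf.1 op2_fst, fun k hk d hd => ?_⟩,
      fun p hp w hw => ?_, fun z hz w hw => ?_⟩
    · exact ⟨(hf.2 k hk _ (hD.op2 hf.1 (hKD hk) hd)).2, (hf.2 _ (hf.2 k hk d hd).2 d hd).1⟩
    · exact ⟨(hfP p hp _ (hfP p hp w hw).1).2, hWW hf.1 (hfP p hp w hw).2 hw⟩
    · exact (hfP _ (hfα z hz w hw) w hw).1
  have hcomp : ∀ g₁ g₂, 𝓕 g₁ → 𝓕 g₂ → 𝓕 fun x y => g₂ (g₁ x y) y := by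
    intro g₁ g₂ hg₁ hg₂
    refine ⟨⟨hg₂.1.1.comp2 hg₁.1.1 op2_fst.flip, fun k hk d hd => ⟨?_, ?_⟩⟩, fun p hp w hw => ⟨?_, ?_⟩,
      fun z hz w hw => ?_⟩
    · exact (hg₂.1.2 _ (hg₁.1.2 k hk d hd).1 d hd).1
    · exact (hg₂.1.2 k hk _ (hKD (hg₁.1.2 k hk d hd).2)).2
    · exact hWW hg₂.1.1 (hg₁.2.1 p hp w hw).1 hw
    · exact (hg₂.2.1 p hp _ (hg₁.2.1 p hp w hw).2).2
    · exact hg₂.2.2 z hz _ (hg₁.2.2 z hz w hw)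
  have hval : ∀ {g}, A.Op2 g → ∀ z ∈ α, ∀ w ∈ W, g z w ∈ P ∨ g z w ∈ α := fun {g} hg z hz w hw =>
    hsplit _ (hX2 hg hz.1 (hWX hw) hNne hz.2.ge (hWNb w hw N hNK))
      (hNb2 hg hz.2.ge (hWNb w hw N hNK))
  by_cases hbad : ∀ z ∈ α, ∀ v ∈ W, ∃ g, 𝓕 g ∧ g z v ∈ W
  · have hall : ∀ s : Finset (A.carrier × A.carrier), ∃ g, 𝓕 g ∧
        ∀ p ∈ s, p.1 ∈ α → p.2 ∈ W → g p.1 p.2 ∈ W := by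
      intro s
      induction s using Finset.induction_on with
      | empty => exact ⟨F, hF, by simp⟩
      | insert p s _ ih =>
        obtain ⟨g₁, hg₁, hgs⟩ := ih
        by_cases hp : p.1 ∈ α ∧ p.2 ∈ W
        · obtain ⟨g₂, hg₂, hgp⟩ : ∃ g₂, 𝓕 g₂ ∧ g₂ (g₁ p.1 p.2) p.2 ∈ W := by
            rcases hval hg₁.1.1 p.1 hp.1 p.2 hp.2 with h | h
            · exact ⟨F, hF, (hF.2.1 _ h _ hp.2).1⟩
            · exact hbad _ h _ hp.2
          refine ⟨_, hcomp g₁ g₂ hg₁ hg₂, fun p' hp' h1 h2 => ?_⟩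
          rcases Finset.mem_insert.mp hp' with rfl | hp'
          · exact hgp
          · exact hWW hg₂.1.1 (hgs p' hp' h1 h2) h2
        · refine ⟨g₁, hg₁, fun p' hp' h1 h2 => ?_⟩
          rcases Finset.mem_insert.mp hp' with rfl | hp'
          · exact absurd ⟨h1, h2⟩ hp
          · exact hgs p' hp' h1 h2
    have := Fintype.ofFinite A.carrier
    obtain ⟨g, hg, hgall⟩ := hall Finset.univ
    have hPα : P ∪ α ∈ good := by
      refine ⟨hWP.trans Set.subset_union_left, Set.union_subset hPX fun x hx => hx.1, ?_, g, hg.1, ?_⟩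
      · rintro x (hx | hx) x' hx' hsub
        · exact Or.inl (hPup x hx x' hx' hsub)
        · exact hsplit x' hx' (hx.2 ▸ hsub)
      · rintro p (hp | hp) w hw
        · exact hg.2.1 p hp w hw
        · exact ⟨hgall (p, w) (Finset.mem_univ _) hp hw, hg.2.2 p hp w hw⟩
    exact hz₀P (hPmax.le_of_ge hPα Set.subset_union_left (Or.inr ⟨hz₀X, rfl⟩))
  · push Not at hbad
    obtain ⟨z, hz, v, hv, hzv⟩ := hbad
    have hzvP : ∀ g, 𝓕 g → g z v ∉ P := fun g hg hP =>
      hzv _ (hcomp g F hg hF) (hF.2.1 _ hP v hv).1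
    have hFN : ∀ n ∈ N, ∀ k ∈ K, F n k ∈ N := hαW hF.1.1 ⟨z, hz, v, hv, hzvP F hF⟩
    have hnoabs : ∀ q, A.Op2 q → (∀ n ∈ N, ∀ k ∈ K, q n k ∈ N) →
        ¬ ∀ n ∈ N, ∀ k ∈ K, q k n ∈ N := by
      intro q hq hq1 hq2
      refine hGN (fun x y => q (F x y) (F y x))
        ⟨hq.comp2 hF.1.1 hF.1.1.flip, fun k hk d hd => ?_⟩ (fun n hn k hk => ?_) fun n hn k hk => ?_
      · have := hF.1.2 k hk d hd
        exact ⟨hK.op2 hq this.1 this.2, hK.op2 hq this.2 this.1⟩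
      · exact hq1 _ (hFN n hn k hk) _ (hK.op2 hF.1.1 hk (hNK hn))
      · exact hq2 _ (hFN n hn k hk) _ (hK.op2 hF.1.1 hk (hNK hn))
    have hgen : ∀ q, A.Op2 q → (∀ z ∈ α, ∀ w ∈ W, q w z ∈ P) → q z v ∉ W := by
      intro q hq hqα hqW
      refine hzv (fun x y => F (q x y) (F x y)) ⟨⟨hF.1.1.comp2 hq hF.1.1, fun k hk d hd => ?_⟩,
        fun p hp w hw => ⟨?_, ?_⟩, fun z hz w hw => ?_⟩ ?_
      · have := hF.1.2 k hk d hd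
        exact ⟨(hF.1.2 _ this.1 _ (hD.op2 hq (hKD hk) hd)).2,
          (hF.1.2 _ this.2 _ (hD.op2 hq hd (hKD hk))).2⟩
      · have hpX := hPX hp
        have hne' : (Nb p).Nonempty := hpX.2.imp fun k hk => hk
        have hs := hWNb w hw _ (hNbK p)
        exact (hF.2.1 _ (hPup p hp _ (hX2 hq hpX (hWX hw) hne' subset_rfl hs)
          (hNb2 hq subset_rfl hs)) _ (hF.2.1 p hp w hw).1).1
      · have hpX := hPX hp
        have hne' : (Nb p).Nonempty := hpX.2.imp fun k hk => hk
        have hs := hWNb w hw _ (hNbK p)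
        exact (hF.2.1 _ (hPup p hp _ (hX2 hq (hWX hw) hpX hne' hs subset_rfl)
          (hNb2 hq hs subset_rfl)) _ (hF.2.1 p hp w hw).2).1
      · exact (hF.2.1 _ (hqα z hz w hw) _ (hF.2.2 z hz w hw)).1
      · rcases hval hF.1.1 z hz v hv with h | h
        · exact absurd h (hzvP F hF)
        · exact hF.2.2 _ h _ hqW
    have hbp : A.BadPair z v R K N W F :=
      { inv := hR
        closed := hK
        sub := hNK
        rel_left := fun k hk => (hz.2.ge hk).2
        near_left := fun k hk hzk => hz.2.le ⟨hk, hzk⟩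
        rel_right := hv.2
        rel_top := fun w hw => hw.2
        mem_top := hv
        ne := hNproper
        no_absorb := hnoabs
        op := hF.1.1
        op_left := hFN
        op_top := by
          intro c hc hcm w hw
          obtain ⟨q, hq, rfl⟩ := mem_closureSet_pair.mp hcm
          have hs := hWNb v hv N hNK
          have hcX := hX2 hq hz.1 (hWX hv) hNne hz.2.ge hs
          rcases hval hq z hz v hv with h | h
          · exact hF.2.1 _ h w hw
          · exact absurd (fun k hk hck => h.2.le ⟨hk, hck⟩) hc
        op_right_left := hF.2.2 z hz v hv
        no_both := by
          intro q hq h1 h2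
          by_cases hα1 : ∀ z ∈ α, ∀ w ∈ W, q w z ∈ P
          · exact hgen q hq hα1 h1
          · by_cases hα2 : ∀ z ∈ α, ∀ w ∈ W, q z w ∈ P
            · exact hgen _ hq.flip hα2 h2
            · push Not at hα1 hα2
              exact hnoabs q hq (hαW hq hα2) (hαW hq.flip hα1) }
    exact hbp.elim hid hsm h1 hmf

end UAlgebra

namespace UAlgebra

variable {σ : Signature} {A : UAlgebra σ}

theorem SwapPair.trans {c d c' d' s t : A.carrier} (h : A.SwapPair c d c' d')
    (h' : A.SwapPair c' d' s t) : A.SwapPair c d s t := by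
  obtain ⟨q, hq, rfl, rfl⟩ := h
  obtain ⟨r, hr, rfl, rfl⟩ := h'
  exact ⟨_, hr.comp2 hq hq.flip, rfl, rfl⟩

/-- A set of self-maps closed under composition contains a map whose image of `S` does not shrink
under precomposition. -/
theorem exists_stable_image {X : Type*} [Finite X] {M : Set (X → X)} (S : Set X)
    (hne : M.Nonempty) (hcomp : ∀ f ∈ M, ∀ g ∈ M, f ∘ g ∈ M)
    (hS : ∀ f ∈ M, ∀ x ∈ S, f x ∈ S) :
    ∃ f ∈ M, ∀ g ∈ M, ∀ x ∈ S, ∃ y ∈ S, f (g y) = f x := by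
  obtain ⟨T, hT⟩ := ((fun f : X → X => f '' S) '' M).toFinite.exists_minimal (hne.image _)
  obtain ⟨f, hf, rfl⟩ := hT.prop
  refine ⟨f, hf, fun g hg x hx => ?_⟩
  have hsub : (f ∘ g) '' S ⊆ f '' S := by
    rintro _ ⟨y, hy, rfl⟩
    exact ⟨g y, hS g hg y hy, rfl⟩
  obtain ⟨y, hy, hyx⟩ := hT.le_of_le ⟨f ∘ g, hcomp f hf g hg, rfl⟩ hsub ⟨x, hx, rfl⟩
  exact ⟨y, hy, hyx⟩

/-- The values at `(b, a, a)` and `(a, a, b)` of the ternary term operations returning `a` at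
`(a, b, b)` and `(b, b, a)`. -/
def MaltsevValue (A : UAlgebra σ) (a b u v : A.carrier) : Prop :=
  ∃ t, A.Op3 t ∧ t a b b = a ∧ t b b a = a ∧ t b a a = u ∧ t a a b = v

namespace MaltsevValue

variable {a b : A.carrier}

theorem symm {u v : A.carrier} (h : A.MaltsevValue a b u v) : A.MaltsevValue a b v u :=
  let ⟨t, ht, h1, h2, h3, h4⟩ := h
  ⟨fun x y z => t z y x, ht.comp (TermOp.proj 2) (TermOp.proj 1) (TermOp.proj 0), h2, h1, h4, h3⟩

theorem swapPair {u v : A.carrier} (h : A.MaltsevValue a b u v) : A.SwapPair a b a u :=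
  let ⟨t, ht, h1, _, h3, _⟩ := h
  ⟨fun x y => t x y y, ht.comp (TermOp.proj 0) (TermOp.proj 1) (TermOp.proj 1), h1, h3⟩

theorem invariant (hid : A.Idempotent) : A.Invariant (A.MaltsevValue a b) := by
  intro f x y h
  choose t ht h1 h2 h3 h4 using h
  refine ⟨fun p q r => A.interp f fun j => t j p q r, TermOp.comp (TermOp.basic f) ht, ?_, ?_, ?_, ?_⟩
  · simp only [h1]; exact hid f a
  · simp only [h2]; exact hid f a
  · simp only [h3]
  · simp only [h4]

theorem op2 {s : A.carrier → A.carrier → A.carrier} (hid : A.Idempotent) (hs : A.Op2 s)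
    (hsa : s a b = a) {u v x : A.carrier} (h : A.MaltsevValue a b u v) (hx : A.SwapPair a b a x) :
    A.MaltsevValue a b (s u x) (s v a) := by
  obtain ⟨t, ht, h1, h2, rfl, rfl⟩ := h
  obtain ⟨q, hq, h3, rfl⟩ := hx
  refine ⟨fun x y z => s (t x y z) (q x y),
    hs.comp ht (hq.comp (TermOp.proj 0) (TermOp.proj 1)), ?_, ?_, rfl, ?_⟩
  · simp only [h1, h3]; exact hs.idem hid a
  · simp only [h2, hq.idem hid]; exact hsa
  · simp only [hq.idem hid]

theorem op3 {s : A.carrier → A.carrier → A.carrier → A.carrier} (hid : A.Idempotent)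
    (hs : A.Op3 s) (hsa : s a b b = a) {u v x y : A.carrier} (h : A.MaltsevValue a b u v)
    (hx : A.SwapPair a b a x) (hy : A.SwapPair a b a y) :
    A.MaltsevValue a b (s u x y) (s v a a) := by
  obtain ⟨t, ht, h1, h2, rfl, rfl⟩ := h
  obtain ⟨q, hq, h3, rfl⟩ := hx
  obtain ⟨r, hr, h4, rfl⟩ := hy
  refine ⟨fun x y z => s (t x y z) (q x y) (r x y),
    hs.comp ht (hq.comp (TermOp.proj 0) (TermOp.proj 1))
      (hr.comp (TermOp.proj 0) (TermOp.proj 1)), ?_, ?_, rfl, ?_⟩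
  · simp only [h1, h3, h4]; exact hs.idem hid a
  · simp only [h2, hq.idem hid, hr.idem hid]; exact hsa
  · simp only [hq.idem hid, hr.idem hid]

theorem exists_left (hid : A.Idempotent) {u v x : A.carrier} (h : A.MaltsevValue a b u v)
    (hx : A.SwapPair a u a x) : ∃ w, A.MaltsevValue a b x w := by
  have hu := h.swapPair
  obtain ⟨t, ht, h1, h2, rfl, rfl⟩ := h
  obtain ⟨q, hq, h3, h4⟩ := hu
  obtain ⟨s, hs, h5, rfl⟩ := hx
  refine ⟨_, fun x y z => s (t x y z) (q z x),
    hs.comp ht (hq.comp (TermOp.proj 2) (TermOp.proj 0)), ?_, ?_, ?_, rfl⟩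
  · simp only [h1, h4]; exact h5
  · simp only [h2, h3]; exact hs.idem hid a
  · simp only [h3]

end MaltsevValue

theorem maltsevValue_of_minimal [Finite A.carrier] (hid : A.Idempotent)
    (hsm : A.IsSmooth) (h1 : A.OmitsType1) (hmf : A.MajorityFree) {a b : A.carrier}
    {D K : Set A.carrier} (hD : ∀ u, u ∈ D ↔ A.SwapPair a b a u)
    (htr : ∀ u ∈ D, A.SwapPair a u a b) (hK : A.IsClosed K) (hKD : K ⊆ D) (hb : b ∈ K)
    (hmin : ∀ S ⊆ K, A.IsClosed S → S.Nonempty → ∀ g, A.Absorbs K D g → A.Absorbs S K g → S = K)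
    {h : A.carrier → A.carrier → A.carrier → A.carrier} (hh : A.Op3 h) (hha : h a b b = a)
    (hha' : h b b a = a) {g : A.carrier → A.carrier → A.carrier} (hg : A.Absorbs K D g)
    (hga : g a b = a) : A.MaltsevValue a b b b := by
  classical
  set Γ := A.MaltsevValue a b with hΓ
  have hΓinv : A.Invariant Γ := MaltsevValue.invariant hid
  have hDcl : A.IsClosed D := by
    intro f x hx
    rw [hD]
    have := SwapPair.invariant f (fun _ => a) x fun j => (hD _).mp (hx j)
    rwa [hid] at this
  have hΓ0 : Γ (h b a a) (h a a b) := ⟨h, hh, hha, hha', rfl, rfl⟩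
  have hΓne : ∀ x ∈ D, ∃ w, Γ x w := fun x hx =>
    hΓ0.exists_left hid ((htr _ ((hD _).mpr hΓ0.swapPair)).trans ((hD x).mp hx))
  -- the monoid of binary operations fixing `a` at `(a, b)`, acting on `D`
  have hact : ∀ s, A.Op2 s → s a b = a → ∀ d ∈ D, s d a ∈ D := by
    intro s hs hsa d hd
    rw [hD]
    have := SwapPair.invariant.op2 hs ((hD d).mp hd) (SwapPair.base (z := a) (v := b)).symm
    rwa [hsa] at this
  obtain ⟨_, ⟨τ, hτ, hτa, rfl⟩, hstab⟩ := exists_stable_image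
    (M := {m | ∃ s, A.Op2 s ∧ s a b = a ∧ m = fun x => s x a}) D
    ⟨_, fun x _ => x, op2_fst, rfl, rfl⟩
    (by
      rintro _ ⟨s, hs, hsa, rfl⟩ _ ⟨s', hs', hsa', rfl⟩
      exact ⟨fun x y => s (s' x y) y, hs.comp2 hs' op2_fst.flip, by simp only [hsa', hsa], rfl⟩)
    (by
      rintro _ ⟨s, hs, hsa, rfl⟩
      exact hact s hs hsa)
  let Y : Set A.carrier := {y | ∃ d ∈ D, τ d a = y}
  have hYD : Y ⊆ D := by
    rintro _ ⟨d, hd, rfl⟩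
    exact hact τ hτ hτa d hd
  have hsurj : ∀ s, A.Op2 s → s a b = a → ∀ y ∈ Y, ∃ y' ∈ Y, τ (s y' a) a = y := by
    rintro s hs hsa _ ⟨d, hd, rfl⟩
    obtain ⟨d', hd', he⟩ := hstab (fun x => s (τ x a) a)
      ⟨fun x y => s (τ x y) y, hs.comp2 hτ op2_fst.flip, by simp only [hτa, hsa], rfl⟩ d hd
    exact ⟨τ d' a, ⟨d', hd', rfl⟩, he⟩
  let I : Set A.carrier := {n | n ∈ D ∧ ∀ y ∈ Y, Γ n y}
  let H : A.carrier → A.carrier → A.carrier → A.carrier := fun x y z => τ (h x y z) y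
  have hH : A.Op3 H := hτ.comp hh (TermOp.proj 1)
  have hHa : H a b b = a := by simp only [H, hha, hτa]
  have hHa' : H b b a = a := by simp only [H, hha', hτa]
  have hf : A.Op2 fun x z => H x z z :=
    hH.comp (TermOp.proj 0) (TermOp.proj 1) (TermOp.proj 1)
  have hfl : ∀ n y d, Γ n y → d ∈ D → Γ (H n d d) (H y a a) := fun n y d hn hd =>
    hn.op3 hid hH hHa ((hD d).mp hd) ((hD d).mp hd)
  have hfr : ∀ n y d, Γ n y → d ∈ D → Γ (H d n n) (H a a y) := fun n y d hn hd =>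
    MaltsevValue.op3 (s := fun x y z => H z y x) hid
      (hH.comp (TermOp.proj 2) (TermOp.proj 1) (TermOp.proj 0)) hHa' hn hn.swapPair ((hD d).mp hd)
  have hpa : ∀ y ∈ Y, ∃ y' ∈ Y, H y' a a = y :=
    hsurj (fun x y => h x y y) (hh.comp (TermOp.proj 0) (TermOp.proj 1) (TermOp.proj 1)) hha
  have hpb : ∀ y ∈ Y, ∃ y' ∈ Y, H a a y' = y :=
    hsurj (fun x y => h y y x) (hh.comp (TermOp.proj 1) (TermOp.proj 1) (TermOp.proj 0)) hha'
  have hIf : ∀ n ∈ I, ∀ d ∈ D, H n d d ∈ I ∧ H d n n ∈ I := by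
    intro n hn d hd
    refine ⟨⟨hDcl.op2 hf hn.1 hd, fun y hy => ?_⟩, hDcl.op2 hf hd hn.1, fun y hy => ?_⟩
    · obtain ⟨y', hy', rfl⟩ := hpa y hy
      exact hfl n y' d (hn.2 y' hy') hd
    · obtain ⟨y', hy', rfl⟩ := hpb y hy
      exact hfr n y' d (hn.2 y' hy') hd
  have hlist : ∀ (m : ℕ) (L : List A.carrier), L.length = m → (∀ y ∈ L, y ∈ Y) →
      ∃ n ∈ D, ∀ y ∈ L, Γ n y := by
    intro m
    induction m with
    | zero =>
      intro L hL _
      rw [List.length_eq_zero_iff] at hL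
      subst hL
      exact ⟨b, hKD hb, by simp⟩
    | succ m ih =>
      intro L hL hLY
      obtain _ | ⟨y₀, L⟩ := L
      · simp at hL
      choose! pa hpa1 hpa2 using hpa
      obtain ⟨n, hn, hnL⟩ := ih (L.map pa) (by simpa using hL) (by
        intro y hy
        obtain ⟨y', hy', rfl⟩ := List.mem_map.mp hy
        exact hpa1 y' (hLY y' (List.mem_cons_of_mem _ hy')))
      obtain ⟨y₁, hy₁, hy₁₀⟩ := hpb y₀ (hLY y₀ List.mem_cons_self)
      obtain ⟨n', hn'⟩ := hΓne y₁ (hYD hy₁)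
      have hn'D : n' ∈ D := (hD _).mpr hn'.symm.swapPair
      refine ⟨H n n' n', hDcl.op2 hf hn hn'D, fun y hy => ?_⟩
      rcases List.mem_cons.mp hy with rfl | hy
      · rw [← hy₁₀]; exact hfr n' y₁ n hn'.symm hn
      · rw [← hpa2 y (hLY y (List.mem_cons_of_mem _ hy))]
        exact hfl n _ n' (hnL _ (List.mem_map_of_mem hy)) hn'D
  obtain ⟨n₀, hn₀⟩ : I.Nonempty := by
    obtain ⟨n, hn, hnY⟩ := hlist _ Y.toFinite.toFinset.toList rfl (by simp)
    exact ⟨n, hn, fun y hy => hnY y (by simpa using hy)⟩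
  have hIcl : A.IsClosed I := by
    intro f x hx
    refine ⟨hDcl f x fun j => (hx j).1, fun y hy => ?_⟩
    have := hΓinv f x (fun _ => y) fun j => (hx j).2 y hy
    rwa [hid] at this
  -- an absorption of `K` which also absorbs `I`
  have hg' : A.Op2 fun x z => τ (g x z) (g z x) := hτ.comp2 hg.1 hg.1.flip
  have hg'K : ∀ k ∈ K, ∀ d ∈ D, τ (g k d) (g d k) ∈ K ∧ τ (g d k) (g k d) ∈ K :=
    fun k hk d hd =>
      ⟨hK.op2 hτ (hg.2 k hk d hd).1 (hg.2 k hk d hd).2,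
        hK.op2 hτ (hg.2 k hk d hd).2 (hg.2 k hk d hd).1⟩
  have hg'I : ∀ n ∈ I, ∀ d ∈ D, τ (g n d) (g d n) ∈ I := by
    intro n hn d hd
    refine ⟨hDcl.op2 hg' hn.1 hd, fun y hy => ?_⟩
    obtain ⟨y', hy', rfl⟩ := hsurj g hg.1 hga y hy
    exact ((hn.2 y' hy').op2 hid hg.1 hga ((hD d).mp hd)).op2 hid hτ hτa
      ((hD _).mp (hDcl.op2 hg.1 hd hn.1))
  let e : A.carrier → A.carrier → A.carrier := fun x z =>
    H (τ (g x z) (g z x)) (τ (g z x) (g x z)) (τ (g z x) (g x z))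
  have heK : A.Absorbs K D e := by
    refine ⟨hf.comp2 hg' hg'.flip, fun k hk d hd => ?_⟩
    have := hg'K k hk d hd
    exact ⟨hK.op2 hf this.1 this.2, hK.op2 hf this.2 this.1⟩
  have heI : ∀ n ∈ I, ∀ d ∈ D, e n d ∈ I ∧ e d n ∈ I := fun n hn d hd =>
    hIf _ (hg'I n hn d hd) _ (hDcl.op2 hg' hd hn.1)
  have hIK : I ∩ K = K := by
    refine hmin _ Set.inter_subset_right (fun f x hx => ⟨hIcl f x fun j => (hx j).1,
      hK f x fun j => (hx j).2⟩) ?_ e heK ⟨heK.1, fun s hs k hk => ?_⟩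
    · exact ⟨e n₀ b, (heI n₀ hn₀ b (hKD hb)).1, (heK.2 b hb n₀ hn₀.1).2⟩
    · exact ⟨⟨(heI s hs.1 k (hKD hk)).1, (heK.2 s hs.2 k (hKD hk)).1⟩,
        (heI s hs.1 k (hKD hk)).2, (heK.2 s hs.2 k (hKD hk)).2⟩
  have hKY : ∀ k ∈ K, ∀ y ∈ Y, Γ k y := fun k hk => (hIK.ge hk).1.2
  obtain ⟨f, hfK, hfW⟩ := exists_absorbs_top hid hsm h1 hmf hDcl hK hKD ⟨b, hb⟩ hΓinv ⟨g, hg⟩ hmin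
  have hyY : τ b a ∈ Y := ⟨b, hKD hb, rfl⟩
  set y := τ b a
  have hyD : y ∈ D := hYD hyY
  have hyb := hg.2 b hb y hyD
  have hx₀ : Γ (g y b) (g b y) := hΓinv.op2 hg.1 (hKY b hb y hyY).symm (hKY b hb y hyY)
  have hw₀K := (hfK.2 _ hyb.2 y hyD).1
  have hw₀ := (hfW _ (hKD hyb.2) ⟨_, hyb.1, hx₀⟩ y hyD fun k hk => (hKY k hk y hyY).symm).1
  have hS : {w | w ∈ K ∧ ∀ k ∈ K, Γ w k} = K := by
    refine hmin _ (fun w hw => hw.1) (fun f x hx => ⟨hK f x fun j => (hx j).1, fun k hk => ?_⟩)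
      ⟨_, hw₀K, hw₀⟩ f hfK ⟨hfK.1, fun s hs k hk => ?_⟩
    · have := hΓinv f x (fun _ => k) fun j => (hx j).2 k hk
      rwa [hid] at this
    · have := hfW k (hKD hk) ⟨_, hw₀K, (hw₀ k hk).symm⟩ s (hKD hs.1) hs.2
      exact ⟨⟨(hfK.2 s hs.1 k (hKD hk)).1, this.2⟩, (hfK.2 s hs.1 k (hKD hk)).2, this.1⟩
  exact (hS.ge hb).2 b hb

end UAlgebra

namespace UAlgebra

variable {σ : Signature} {A : UAlgebra σ}

theorem SwapPair.mem_right {z v s t : A.carrier} (h : A.SwapPair z v s t) :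
    t ∈ A.ClosureSet {z, v} := h.symm.mem

/-- A map to a module which turns the binary term operations on `C` into affine combinations and
some ternary term operation into `x - y + z`. -/
structure AffineMap (A : UAlgebra σ) (R : Type*) {M : Type*} [Ring R] [AddCommGroup M] [Module R M]
    (C : Set A.carrier) (φ : A.carrier → M) (h : A.carrier → A.carrier → A.carrier → A.carrier) :
    Prop where
  closed : A.IsClosed C
  op2 : ∀ g, A.Op2 g → ∃ c d : R, c + d = 1 ∧ ∀ x ∈ C, ∀ y ∈ C, φ (g x y) = c • φ x + d • φ y
  op : A.Op3 h
  map_op : ∀ x ∈ C, ∀ y ∈ C, ∀ z ∈ C, φ (h x y z) = φ x - φ y + φ z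

namespace AffineMap

variable {R M : Type*} [Ring R] [AddCommGroup M] [Module R M] {C : Set A.carrier}
  {φ : A.carrier → M} {h : A.carrier → A.carrier → A.carrier → A.carrier}

theorem map_swapPair (H : A.AffineMap R C φ h) {a b s t : A.carrier} (ha : a ∈ C) (hb : b ∈ C)
    (hst : A.SwapPair a b s t) : φ s + φ t = φ a + φ b := by
  obtain ⟨q, hq, rfl, rfl⟩ := hst
  obtain ⟨c, d, hcd, hφ⟩ := H.op2 q hq
  rw [hφ a ha b hb, hφ b hb a ha]
  obtain rfl : d = 1 - c := eq_sub_of_add_eq' hcd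
  simp only [sub_smul, one_smul]
  abel

/-- If every pair in `B` with the same images as `a` and `b` generates `B`, then some ternary term
operation returns `a` at `(a, b, b)` and at `(b, b, a)`. -/
theorem exists_maltsev [Finite A.carrier] (H : A.AffineMap R C φ h) (hid : A.Idempotent)
    {a b : A.carrier} {B : Set A.carrier} (hBcl : A.IsClosed B) (hBC : B ⊆ C) (ha : a ∈ B)
    (hb : b ∈ B) (hgen : ∀ c ∈ B, φ c = φ a → B ⊆ A.ClosureSet {c, b}) :
    ∃ k, A.Op3 k ∧ k a b b = a ∧ k b b a = a := by
  let S : Set A.carrier := {c | c ∈ B ∧ φ c = φ a}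
  have haS : a ∈ S := ⟨ha, rfl⟩
  have htr : ∀ c ∈ S, ∀ c' ∈ S, ∃ s, A.Op2 s ∧ s c b = c' := fun c hc c' hc' =>
    mem_closureSet_pair.mp (hgen c hc.1 hc.2 hc'.1)
  obtain ⟨_, ⟨τ, hτ, rfl, hτS⟩, hstab⟩ := exists_stable_image
    (M := {m | ∃ s, A.Op2 s ∧ m = (fun x => s x b) ∧ ∀ c ∈ S, s c b ∈ S}) S
    ⟨_, _, op2_fst, rfl, fun c hc => hc⟩
    (by
      rintro _ ⟨s, hs, rfl, hsS⟩ _ ⟨s', hs', rfl, hsS'⟩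
      exact ⟨_, hs.comp2 hs' op2_fst.flip, rfl, fun c hc => hsS _ (hsS' c hc)⟩)
    (by
      rintro _ ⟨s, -, rfl, hsS⟩
      exact hsS)
  have hl : A.Op2 fun x y => h x y y :=
    H.op.comp (TermOp.proj 0) (TermOp.proj 1) (TermOp.proj 1)
  have hr : A.Op2 fun x y => h y y x :=
    H.op.comp (TermOp.proj 1) (TermOp.proj 1) (TermOp.proj 0)
  obtain ⟨c₁, hc₁, he₁⟩ := hstab _ ⟨_, hl, rfl, fun c hc => ⟨hBcl.op2 hl hc.1 hb, by
    rw [H.map_op _ (hBC hc.1) _ (hBC hb) _ (hBC hb), hc.2]; abel⟩⟩ a haS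
  obtain ⟨c₂, hc₂, he₂⟩ := hstab _ ⟨_, hr, rfl, fun c hc => ⟨hBcl.op2 hr hc.1 hb, by
    rw [H.map_op _ (hBC hb) _ (hBC hb) _ (hBC hc.1), hc.2]; abel⟩⟩ a haS
  obtain ⟨i₁, hi₁, rfl⟩ := htr a haS c₁ hc₁
  obtain ⟨i₂, hi₂, rfl⟩ := htr a haS c₂ hc₂
  obtain ⟨m, hm, hme⟩ := htr _ (hτS a haS) a haS
  refine ⟨fun x y z => m (τ (h (i₁ x y) y (i₂ z y)) y) y, ?_, ?_, ?_⟩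
  · exact hm.comp (hτ.comp (H.op.comp (hi₁.comp (TermOp.proj 0) (TermOp.proj 1)) (TermOp.proj 1)
      (hi₂.comp (TermOp.proj 2) (TermOp.proj 1))) (TermOp.proj 1)) (TermOp.proj 1)
  · simp only [hi₂.idem hid, he₁, hme]
  · simp only [hi₁.idem hid, he₂, hme]

/-- An absorbing operation can be chosen to preserve the image of its first argument. -/
theorem exists_absorbs (H : A.AffineMap R C φ h) {K D : Set A.carrier} (hK : A.IsClosed K)
    (hKD : K ⊆ D) {g : A.carrier → A.carrier → A.carrier} (hg : A.Absorbs K D g) :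
    ∃ g, A.Absorbs K D g ∧ ∀ x ∈ C, ∀ y ∈ C, φ (g x y) = φ x := by
  refine ⟨fun x y => h (g x (g x y)) (g x y) (g (g x y) x), ⟨?_, fun k hk d hd => ?_⟩, ?_⟩
  · have hxy : A.TermOp fun x : Fin 2 → A.carrier => g (x 0) (x 1) := hg.1
    exact H.op.comp (hg.1.comp (TermOp.proj 0) hxy) hxy (hg.1.comp hxy (TermOp.proj 0))
  · have h1 := hg.2 k hk d hd
    have h2 := hg.2 _ h1.1 k (hKD hk)
    have h3 := hg.2 _ h1.2 d hd
    exact ⟨hK.op3 H.op h2.2 h1.1 h2.1, hK.op3 H.op h3.2 h1.2 h3.1⟩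
  · intro x hx y hy
    obtain ⟨c, d, hcd, hφ⟩ := H.op2 g hg.1
    have hxy := H.closed.op2 hg.1 hx hy
    rw [H.map_op _ (H.closed.op2 hg.1 hx hxy) _ hxy _ (H.closed.op2 hg.1 hxy hx), hφ x hx _ hxy,
      hφ _ hxy x hx, hφ x hx y hy]
    obtain rfl : d = 1 - c := eq_sub_of_add_eq' hcd
    simp only [smul_add, sub_smul, one_smul, smul_sub]
    abel

theorem exists_maltsevValue [Finite A.carrier] (H : A.AffineMap R C φ h) (hid : A.Idempotent)
    (hsm : A.IsSmooth) (h1 : A.OmitsType1) (hmf : A.MajorityFree) {a' b' : A.carrier}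
    (ha' : a' ∈ C) (hb' : b' ∈ C) :
    ∃ a ∈ C, ∃ b ∈ C, φ a = φ a' ∧ φ b = φ b' ∧ A.MaltsevValue a b b b := by
  let P : Set (A.carrier × A.carrier) := {p | p.1 ∈ C ∧ p.2 ∈ C ∧ φ p.1 = φ a' ∧ φ p.2 = φ b'}
  -- a pair generating a minimal subalgebra
  obtain ⟨B, hB⟩ := ((fun p : A.carrier × A.carrier => A.ClosureSet {p.1, p.2}) ''
    P).toFinite.exists_minimal (Set.Nonempty.image _ ⟨(a', b'), ha', hb', rfl, rfl⟩)
  obtain ⟨p, hp, hpB⟩ := hB.prop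
  have hBcl : A.IsClosed B := hpB ▸ A.closureSet_isClosed _
  have hp1 : p.1 ∈ B := hpB ▸ mem_closureSet_left p.1 p.2
  have hp2 : p.2 ∈ B := hpB ▸ mem_closureSet_right p.1 p.2
  have hpair : ∀ {S : Set A.carrier} {c d : A.carrier}, A.IsClosed S → c ∈ S → d ∈ S →
      A.ClosureSet {c, d} ⊆ S := by
    intro S c d hS hc hd
    refine closureSet_subset hS ?_
    rintro x (rfl | rfl)
    · exact hc
    · exact hd
  have hBC : B ⊆ C := hpB ▸ hpair H.closed hp.1 hp.2.1
  have hgen : ∀ q ∈ P, q.1 ∈ B → q.2 ∈ B → B ⊆ A.ClosureSet {q.1, q.2} := fun q hq h1 h2 =>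
    hB.le_of_le ⟨q, hq, rfl⟩ (hpair hBcl h1 h2)
  -- among the pairs in `B`, one with a minimal symmetric relation
  obtain ⟨T, hT⟩ := ((fun p : A.carrier × A.carrier => {q : A.carrier × A.carrier |
    A.SwapPair p.1 p.2 q.1 q.2}) '' {p | p ∈ P ∧ p.1 ∈ B ∧ p.2 ∈ B}).toFinite.exists_minimal
    (Set.Nonempty.image _ ⟨p, hp, hp1, hp2⟩)
  obtain ⟨⟨a, b₀⟩, ⟨hab, ha, hb₀⟩, rfl⟩ := hT.prop
  have hpairs : ∀ {c d}, A.SwapPair a b₀ c d → φ c = φ a' →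
      (c, d) ∈ P ∧ c ∈ B ∧ d ∈ B := by
    intro c d hcd hc
    have hcB : c ∈ B := hpair hBcl ha hb₀ hcd.mem
    have hdB : d ∈ B := hpair hBcl ha hb₀ hcd.mem_right
    refine ⟨⟨hBC hcB, hBC hdB, hc, ?_⟩, hcB, hdB⟩
    have := H.map_swapPair hab.1 hab.2.1 hcd
    rw [hc, hab.2.2.1, hab.2.2.2] at this
    exact add_left_cancel this
  have hswap : ∀ {c d}, A.SwapPair a b₀ c d → φ c = φ a' → ∀ {s t}, A.SwapPair a b₀ s t →
      A.SwapPair c d s t := by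
    intro c d hcd hc s t hst
    have hle : {q : A.carrier × A.carrier | A.SwapPair c d q.1 q.2} ⊆
      {q : A.carrier × A.carrier | A.SwapPair a b₀ q.1 q.2} := fun q hq => hcd.trans hq
    exact hT.le_of_le ⟨(c, d), hpairs hcd hc, rfl⟩ hle (a := (s, t)) hst
  let D : Set A.carrier := {u | A.SwapPair a b₀ a u}
  have hDcl : A.IsClosed D := by
    intro f x hx
    have := SwapPair.invariant f (fun _ => a) x hx
    rwa [hid] at this
  obtain ⟨K, hKmin⟩ := {K : Set A.carrier | K ⊆ D ∧ A.IsClosed K ∧ K.Nonempty ∧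
    ∃ g, A.Absorbs K D g}.toFinite.exists_minimal
    ⟨D, subset_rfl, hDcl, ⟨b₀, SwapPair.base⟩, _, op2_fst, fun k hk d hd => ⟨hk, hd⟩⟩
  obtain ⟨hKD, hK, ⟨b, hb⟩, g₀, hg₀⟩ := hKmin.prop
  have hmin : ∀ S ⊆ K, A.IsClosed S → S.Nonempty → ∀ g, A.Absorbs K D g → A.Absorbs S K g →
      S = K := by
    intro S hSK hS hne g hg hgS
    refine hSK.antisymm (hKmin.le_of_le ⟨hSK.trans hKD, hS, hne,
      fun x y => g (g (g x y) x) (g (g y x) y), ?_, fun s hs d hd => ?_⟩ hSK)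
    · exact hg.1.comp2 ((hg.1.comp2 hg.1 op2_fst)) (hg.1.comp2 hg.1.flip op2_fst.flip)
    · have hsd := hg.2 s (hSK hs) d hd
      have h2 := (hgS.2 s hs _ hsd.1).2
      have h3 := (hg.2 _ hsd.2 d hd).1
      exact hgS.2 _ h2 _ h3
  have hab' : A.SwapPair a b₀ a b := hKD hb
  obtain ⟨hbP, -, hbB⟩ := hpairs hab' hab.2.2.1
  have hiff : ∀ {s t}, A.SwapPair a b s t ↔ A.SwapPair a b₀ s t :=
    ⟨fun h => hab'.trans h, fun h => hswap hab' hab.2.2.1 h⟩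
  obtain ⟨k, hk, hka, hka'⟩ := H.exists_maltsev hid hBcl hBC ha hbB fun c hc hca =>
    hgen (c, b) ⟨hBC hc, hbP.2.1, hca.trans hab.2.2.1, hbP.2.2.2⟩ hc hbB
  obtain ⟨g, hg, hgφ⟩ := H.exists_absorbs hK hKD hg₀
  have hgab : A.SwapPair a b (g a b) (g b a) := ⟨g, hg.1, rfl, rfl⟩
  obtain ⟨s, hs, hsa, -⟩ := hswap (hiff.mp hgab)
    ((hgφ a hab.1 b hbP.2.1).trans hab.2.2.1) (hiff.mp SwapPair.base)
  refine ⟨a, hab.1, b, hbP.2.1, hab.2.2.1, hbP.2.2.2, maltsevValue_of_minimal (D := D) hid hsm h1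
    hmf (fun u => hiff.symm) (fun u hu => hswap hu hab.2.2.1 hab') hK hKD hb hmin hk hka hka'
    (g := fun x y => s (g x y) (g y x)) ⟨hs.comp2 hg.1 hg.1.flip, fun x hx d hd => ?_⟩ hsa⟩
  have := hg.2 x hx d hd
  exact ⟨hK.op2 hs this.1 this.2, hK.op2 hs this.2 this.1⟩

end AffineMap

/-- The quotient map of an affine edge. -/
theorem AffWitness.exists_affineMap {a b : A.carrier} {θ : Congruence (A.Sg {a, b})}
    (hθ : A.AffWitness a b θ) :
    ∃ (R M : Type) (_ : Ring R) (_ : AddCommGroup M) (_ : Module R M) (φ : A.carrier → M)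
      (h : A.carrier → A.carrier → A.carrier → A.carrier),
      A.AffineMap R (A.ClosureSet {a, b}) φ h ∧
        ∀ x ∈ A.ClosureSet {a, b}, ∀ y ∈ A.ClosureSet {a, b}, φ x = φ y → θ.lift x y := by
  classical
  obtain ⟨-, R, _, -, _, _, hR, t, ht⟩ := hθ
  let φ : A.carrier → ((A.Sg {a, b}).quot θ).carrier := fun x =>
    if hx : x ∈ A.ClosureSet {a, b} then Quotient.mk θ.toSetoid ⟨x, hx⟩ else A.qa a b θ
  have hφ : ∀ x : (A.Sg {a, b}).carrier, φ x.1 = Quotient.mk θ.toSetoid x := fun x =>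
    dif_pos x.2
  refine ⟨R, _, _, _, _, φ, fun x y z => t.eval A ![x, y, z],
    ⟨A.closureSet_isClosed _, fun g hg => ?_, op3_of_term t, fun x hx y hy z hz => ?_⟩,
    fun x hx y hy hxy => ?_⟩
  · obtain ⟨s, hs⟩ := hg.exists_eval
    obtain ⟨c, hc, hcs⟩ := (hR 2 _).mp ⟨s, fun _ => rfl⟩
    rw [Fin.sum_univ_two] at hc
    refine ⟨c 0, c 1, hc, fun x hx y hy => ?_⟩
    obtain ⟨w, hw, hw'⟩ := θ.eval_quot_two s ⟨x, hx⟩ ⟨y, hy⟩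
    have := hcs ![φ x, φ y]
    rw [Fin.sum_univ_two] at this
    rw [← hs]
    refine (congrArg φ hw.symm).trans (((hφ w).trans hw'.symm).trans (Eq.trans ?_ this))
    rw [hφ ⟨x, hx⟩, hφ ⟨y, hy⟩]
    rfl
  · obtain ⟨w, hw, hw'⟩ := θ.eval_quot_three t ⟨x, hx⟩ ⟨y, hy⟩ ⟨z, hz⟩
    have := ht (φ x) (φ y) (φ z)
    refine (congrArg φ hw.symm).trans (((hφ w).trans hw'.symm).trans (Eq.trans ?_ this))
    rw [hφ ⟨x, hx⟩, hφ ⟨y, hy⟩, hφ ⟨z, hz⟩]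
    rfl
  · rw [hφ ⟨x, hx⟩, hφ ⟨y, hy⟩] at hxy
    exact (θ.mk_eq_mk_iff _ _).mp hxy

end UAlgebra

/-- in a smooth majority free finite idempotent algebra omitting
type 1, every affine edge `a'b'` witnessed by a maximal congruence `θ`
contains a Mal'tsev edge `ab` with `a ∈ a'/θ` and `b ∈ b'/θ`. -/
theorem stmt_13 (σ : Signature) (A : UAlgebra σ)
    (hfin : Finite A.carrier) (hne : Nonempty A.carrier) (hid : A.Idempotent)
    (hsm : A.IsSmooth) (h1 : A.OmitsType1) (hmf : A.MajorityFree)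
    (a' b' : A.carrier) (hab : a' ≠ b')
    (θ : UAlgebra.Congruence (A.Sg {a', b'}))
    (hθ : UAlgebra.AffWitness A a' b' θ) :
    ∃ a b : A.carrier,
      (∃ ha : a ∈ A.ClosureSet {a', b'}, θ.rel ⟨a, ha⟩ (A.sgA a' b')) ∧
      (∃ hb : b ∈ A.ClosureSet {a', b'}, θ.rel ⟨b, hb⟩ (A.sgB a' b')) ∧
      A.IsMaltsevEdge a b := by
  obtain ⟨R, M, _, _, _, φ, h, H, hφ⟩ := hθ.exists_affineMap
  have ha' := UAlgebra.mem_closureSet_left (A := A) a' b'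
  have hb' := UAlgebra.mem_closureSet_right (A := A) a' b'
  obtain ⟨a, ha, b, hb, hφa, hφb, t, ht, h₁, h₂, h₃, h₄⟩ :=
    H.exists_maltsevValue hid hsm h1 hmf ha' hb'
  refine ⟨a, b, ⟨ha, (hφ a ha a' ha' hφa).2.2⟩, ⟨hb, (hφ b hb b' hb' hφb).2.2⟩, ?_⟩
  obtain ⟨s, hs⟩ := ht.exists_eval
  refine ⟨s, ?_⟩
  simp only [IsMaltsevOn, hs]
  rintro x (rfl | rfl) y (rfl | rfl)
  · exact ⟨ht.idem hid _, ht.idem hid _⟩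
  · exact ⟨h₁, h₂⟩
  · exact ⟨h₃, h₄⟩
  · exact ⟨ht.idem hid _, ht.idem hid _⟩
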